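/- There is an absolute constant C > 0 such that the following holds. Let G be a finite abelian group and A ⊆ G nonempty with m_G(A+A) ≤ K·m_G(A). Then there is a Bohr system B on G with C^Δ(A;B₁) ≤ exp(C·log³(2K)·(log(2·log(2K)))⁴) and dim B ≤ C·log³(2K)·(log(2·log(2K)))⁴, such that ‖1_A ∗ β‖_{L_∞} ≥ exp(−C·log(2K)·log(2·log(2K))) for every probability measure β on G supported on B₁. -/

import Mathlib

open scoped BigOperators Pointwise ENNReal ENat
open Real

namespace Paper

noncomputable section

/-- For `z` on the unit circle, `circNorm z = min {|θ| : z = exp(2πiθ)}`. -/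
def circNorm (z : ℂ) : ℝ := |z.arg| / (2 * Real.pi)

variable {G : Type} [AddCommGroup G]

/-- The (generalised) Bohr set with frequency set `Γ` and width function `δ`. -/
def bohrSet (Γ : Set (AddChar G ℂ)) (δ : AddChar G ℂ → ℝ) : Set G :=
  {x | ∀ γ ∈ Γ, circNorm (γ x) < δ γ}

/-- `(Γ, δ)` generates the family of sets `F` as a Bohr system. -/
def IsBohrGen (Γ : Set (AddChar G ℂ)) (δ : AddChar G ℂ → ℝ) (F : ℝ → Set G) : Prop :=
  (∀ γ ∈ Γ, 0 < δ γ) ∧ ∀ η : ℝ, 0 < η → η ≤ 1 → F η = bohrSet Γ (fun γ => η * δ γ)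

/-- A Bohr system: a family `(B_η)_{η ∈ (0,1]}` of subsets of `G` of the form
`B_η = Bohr(Γ, ηδ)` for some generating pair `(Γ, δ)`. -/
structure BohrSystem (G : Type) [AddCommGroup G] where
  sets : ℝ → Set G
  exists_gen : ∃ Γ δ, IsBohrGen Γ δ sets

/-- The covering number `C(S;T) = min {|X| : S ⊆ X + T}`, valued in `ℕ∞`. -/
def coveringNumber {H : Type} [AddCommGroup H] (S T : Set H) : ℕ∞ :=
  sInf {n : ℕ∞ | ∃ X : Finset H, (X.card : ℕ∞) = n ∧ S ⊆ (X : Set H) + T}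

/-- Auxiliary quantity for the difference covering number, for a fixed target group `H`. -/
def dCovAux (S T : Set G) (H : Type) [AddCommGroup H] : ℕ∞ :=
  ⨅ (φ : G →+ H) (U : Set H) (V : Set H) (_ : S ⊆ φ ⁻¹' U) (_ : φ ⁻¹' (V - V) ⊆ T),
    coveringNumber U V

/-- The difference covering number `C^Δ(S;T)`: the infimum of `C_H(U;V)` over all abelian
groups `H`, homomorphisms `φ : G → H` and sets `U, V ⊆ H` with `S ⊆ φ⁻¹(U)` and
`φ⁻¹(V − V) ⊆ T`. -/
def dCoveringNumber (S T : Set G) : ℕ∞ :=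
  ⨅ (H : Type) (inst : AddCommGroup H), @dCovAux G _ S T H inst

/-- Interpret an extended natural number as a real number. -/
def enatReal (n : ℕ∞) : ℝ := (n.toNat : ℝ)

/-- The dimension of a family of sets: `sup {log₂ C^Δ(F_η; F_{η/2}) : η ∈ (0,1]}`. -/
def dimOfSets (F : ℝ → Set G) : ℝ :=
  sSup {r : ℝ | ∃ η : ℝ, 0 < η ∧ η ≤ 1 ∧
    r = Real.logb 2 (enatReal (dCoveringNumber (F η) (F (η / 2))))}

/-- The dimension `dim B` of a Bohr system. -/
def BohrSystem.dim (B : BohrSystem G) : ℝ := dimOfSets B.sets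

/-- The doubling dimension of a family of sets:
`sup {log₂ C(F_η; F_{η/2}) : η ∈ (0,1]}`. -/
def dimStarOfSets (F : ℝ → Set G) : ℝ :=
  sSup {r : ℝ | ∃ η : ℝ, 0 < η ∧ η ≤ 1 ∧
    r = Real.logb 2 (enatReal (coveringNumber (F η) (F (η / 2))))}

/-- The doubling dimension `dim* B` of a Bohr system. -/
def BohrSystem.dimStar (B : BohrSystem G) : ℝ := dimStarOfSets B.sets

/-- `B' ≤ B` for Bohr systems, i.e. `B' ∧ B = B'`, i.e. `B'_η ⊆ B_η` for all `η ∈ (0,1]`. -/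
def BohrSystem.le (B' B : BohrSystem G) : Prop :=
  ∀ η : ℝ, 0 < η → η ≤ 1 → B'.sets η ⊆ B.sets η

/-- The width of a Bohr system: `inf {‖δ‖_{ℓ∞(Γ)} : (Γ,δ) generates B}`. -/
def BohrSystem.width (B : BohrSystem G) : ℝ :=
  sInf {r : ℝ | ∃ Γ δ, IsBohrGen Γ δ B.sets ∧ r = sSup (δ '' Γ)}

/-- The `n`-fold sumset `nS = S + ⋯ + S`. -/
def iterSum : ℕ → Set G → Set G
  | 0, _ => {0}
  | n + 1, S => S + iterSum n S

/-- The set of all cosets of subgroups of `G`. -/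
def cosets (G : Type) [AddCommGroup G] : Set (Set G) :=
  {W | ∃ (H : AddSubgroup G) (x : G), W = (fun h => x + h) '' (H : Set G)}

/-- The set of cosets of a fixed subgroup `H` of `G`. -/
def cosetsOf (H : AddSubgroup G) : Set (Set G) :=
  {W | ∃ x : G, W = (fun h => x + h) '' (H : Set G)}

/-- `f` is `ε`-almost integer-valued, with integer part `fZ`. -/
def AlmostInt (ε : ℝ) (f : G → ℂ) (fZ : G → ℤ) : Prop :=
  ∀ x, ‖f x - (fZ x : ℂ)‖ ≤ ε

/-- The `ρ`-approximate annihilator `N(S,ρ)` of a set `S ⊆ G`. -/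
def annihilator (S : Set G) (ρ : ℝ) : Set (AddChar G ℂ) :=
  {γ | ∀ x ∈ S, ‖(1 : ℂ) - γ x‖ < ρ}

/-- `A` is `(m,l)`-arithmetically connected. -/
def ArithConnected (m l : ℕ) (A : Set G) : Prop :=
  ∀ x : Fin m → G, (∀ i, x i ∈ A) →
    ∃ σ : Fin m → ℤ, (∑ i, (σ i).natAbs) ≤ l ∧
      (∃ i j, i ≠ j ∧ (σ i).natAbs = 1 ∧ (σ j).natAbs = 1) ∧
      (∑ i, σ i • x i) ∈ A

variable [Fintype G]

/-- The Haar probability measure of a subset of the finite group `G`. -/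
def haar (S : Set G) : ℝ := (Nat.card S : ℝ) / (Fintype.card G : ℝ)

/-- A probability measure on the finite group `G`, given by its weight function. -/
def IsProb (w : G → ℝ) : Prop := (∀ x, 0 ≤ w x) ∧ ∑ x, w x = 1

/-- The measure of `S` under the weight function `w`. -/
def wMeasure (w : G → ℝ) (S : Set G) : ℝ := ∑ x, S.indicator w x

/-- The probability measure `μ_S`: `μ` restricted to `S` and normalised. -/
def restrictProb (w : G → ℝ) (S : Set G) : G → ℝ :=
  fun x => S.indicator w x / wMeasure w S

/-- The probability measure `w` is `F`-approximately invariant: for every `η ∈ (0,1]` there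
are probability measures `w⁺, w⁻` with `(1−η)·w⁻ ≤ τ_x(w) ≤ (1+η)·w⁺` for all `x ∈ F η`. -/
def ApproxInvariant (F : ℝ → Set G) (w : G → ℝ) : Prop :=
  ∀ η : ℝ, 0 < η → η ≤ 1 → ∃ wp wm : G → ℝ, IsProb wp ∧ IsProb wm ∧
    ∀ x ∈ F η, ∀ y : G, (1 - η) * wm y ≤ w (y - x) ∧ w (y - x) ≤ (1 + η) * wp y

/-- The Fourier coefficient `f̂(γ) = (1/|G|) ∑_x f(x) conj(γ(x))`. -/
def fourierCoeff (f : G → ℂ) (γ : AddChar G ℂ) : ℂ :=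
  (Fintype.card G : ℂ)⁻¹ * ∑ x, f x * (starRingEnd ℂ) (γ x)

/-- The Wiener norm `‖f‖_{A(G)} = ∑_γ |f̂(γ)|`. -/
def wienerNorm (f : G → ℂ) : ℝ := ∑ᶠ γ : AddChar G ℂ, ‖fourierCoeff f γ‖

/-- The Fourier transform `μ̂(γ) = ∫ conj(γ(x)) dμ(x)` of a measure with weight `w`. -/
def fourierWeight (w : G → ℝ) (γ : AddChar G ℂ) : ℂ :=
  ∑ x, (starRingEnd ℂ) (γ x) * (w x : ℂ)

/-- Convolution `f ∗ μ (x) = ∫ f(x−y) dμ(y)` of a complex function with a measure. -/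
def convC (f : G → ℂ) (w : G → ℝ) (x : G) : ℂ := ∑ y, f (x - y) * (w y : ℂ)

/-- Convolution `f ∗ μ (x) = ∫ f(x−y) dμ(y)` of a real function with a measure. -/
def convR (f : G → ℝ) (w : G → ℝ) (x : G) : ℝ := ∑ y, f (x - y) * w y

/-- Convolution of functions w.r.t. Haar measure: `f ∗ g (x) = (1/|G|) ∑_y f(y) g(x−y)`. -/
def convFun (f g : G → ℝ) (x : G) : ℝ := (Fintype.card G : ℝ)⁻¹ * ∑ y, f y * g (x - y)

/-- The `L_p` norm `(∫ |f|^p dν)^{1/p}` w.r.t. the measure with weight `w`. -/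
def LpW (p : ℝ) (w : G → ℝ) (f : G → ℂ) : ℝ := (∑ y, w y * ‖f y‖ ^ p) ^ (1 / p)

/-- `X` has relative polynomial growth of order `d`. -/
def HasRPG (X : Set G) (d : ℝ) : Prop :=
  ∀ n : ℕ, 1 ≤ n → haar (iterSum n X) ≤ (n : ℝ) ^ d * haar X

end

lemma chernoff_one {α : Type} [DecidableEq α] (A : Finset α) (g : α → ℝ)
    (hg : ∀ a ∈ A, |g a| ≤ 1) (hs : ∑ a ∈ A, g a = 0) (m : ℕ) (δ : ℝ) (hδ : 0 < δ) (hδ1 : δ ≤ 1) :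
    (((Fintype.piFinset (fun _ : Fin m => A)).filter
      (fun a => δ * m < ∑ i, g (a i))).card : ℝ) ≤ Real.exp (-(δ ^ 2 * m / 4)) * (A.card : ℝ) ^ m := by
  set P := Fintype.piFinset (fun _ : Fin m => A) with hP
  set t := δ / 2 with ht
  have h1 : ∑ a ∈ P, ∏ i, Real.exp (t * g (a i)) = (∑ a ∈ A, Real.exp (t * g a)) ^ m := by
    have := Finset.prod_univ_sum (fun _ : Fin m => A) (fun _ a => Real.exp (t * g a))
    rw [hP, ← this]; simp
  have h2 : ∑ a ∈ A, Real.exp (t * g a) ≤ Real.exp (t ^ 2) * A.card := by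
    have : ∀ a ∈ A, Real.exp (t * g a) ≤ 1 + t * g a + t ^ 2 := by
      intro a ha
      have hga := hg a ha
      have hx : |t * g a| ≤ 1 := by
        rw [abs_mul, abs_of_pos (by positivity)]
        nlinarith [abs_nonneg (g a)]
      have := (abs_le.1 (Real.abs_exp_sub_one_sub_id_le hx)).2
      have h3 : (t * g a) ^ 2 ≤ t ^ 2 := by
        rw [mul_pow]
        have : g a ^ 2 ≤ 1 := by rw [← sq_abs]; nlinarith [abs_nonneg (g a)]
        nlinarith [sq_nonneg t]
      linarith
    calc _ ≤ ∑ a ∈ A, (1 + t * g a + t ^ 2) := Finset.sum_le_sum this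
      _ = (1 + t ^ 2) * A.card := by
        rw [Finset.sum_add_distrib, Finset.sum_add_distrib, ← Finset.mul_sum, hs]; simp; ring
      _ ≤ _ := by
        gcongr
        linarith [Real.add_one_le_exp (t ^ 2)]
  have h3 : ((P.filter (fun a => δ * m < ∑ i, g (a i))).card : ℝ) * Real.exp (t * (δ * m)) ≤
      ∑ a ∈ P, ∏ i, Real.exp (t * g (a i)) := by
    rw [← nsmul_eq_mul, ← Finset.sum_const]
    refine (Finset.sum_le_sum (g := fun a : Fin m → α => ∏ i, Real.exp (t * g (a i))) ?_).trans
      (Finset.sum_le_sum_of_subset_of_nonneg (Finset.filter_subset _ _) ?_)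
    · intro a ha
      rw [← Real.exp_sum, ← Finset.mul_sum]
      have := (Finset.mem_filter.1 ha).2
      gcongr
    · intros; positivity
  have h4 : (∑ a ∈ A, Real.exp (t * g a)) ^ m ≤ (Real.exp (t ^ 2) * A.card) ^ m := by
    gcongr
  rw [h1] at h3
  have h5 := h3.trans h4
  rw [mul_pow, ← Real.exp_nat_mul] at h5
  rw [← le_div_iff₀ (Real.exp_pos _)] at h5
  refine h5.trans (le_of_eq ?_)
  rw [div_eq_mul_inv, ← Real.exp_neg, mul_right_comm, ← Real.exp_add]
  congr 2
  rw [ht]; ring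

lemma chernoff {α : Type} [DecidableEq α] (A : Finset α) (hA : A.Nonempty) (f : α → ℝ)
    (hf0 : ∀ a ∈ A, 0 ≤ f a) (hf1 : ∀ a ∈ A, f a ≤ 1) (h : ℝ) (hs : ∑ a ∈ A, f a = h * A.card)
    (m : ℕ) (δ : ℝ) (hδ : 0 < δ) (hδ1 : δ ≤ 1) :
    (((Fintype.piFinset (fun _ : Fin m => A)).filter
      (fun a => δ * m < |∑ i, f (a i) - m * h|)).card : ℝ) ≤
      2 * Real.exp (-(δ ^ 2 * m / 4)) * (A.card : ℝ) ^ m := by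
  have hc : (0 : ℝ) < A.card := by exact_mod_cast hA.card_pos
  have h0 : 0 ≤ h := by
    have : 0 ≤ h * A.card := hs ▸ Finset.sum_nonneg hf0
    exact nonneg_of_mul_nonneg_left this hc
  have h1 : h ≤ 1 := by
    have : h * A.card ≤ 1 * A.card := by
      rw [← hs]; simpa using Finset.sum_le_sum hf1
    exact le_of_mul_le_mul_right this hc
  have e1 := chernoff_one A (fun a => f a - h)
    (fun a ha => abs_le.2 ⟨by linarith [hf0 a ha], by linarith [hf1 a ha]⟩)
    (by rw [Finset.sum_sub_distrib, hs]; simp; ring) m δ hδ hδ1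
  have e2 := chernoff_one A (fun a => h - f a)
    (fun a ha => abs_le.2 ⟨by linarith [hf1 a ha], by linarith [hf0 a ha]⟩)
    (by rw [Finset.sum_sub_distrib, hs]; simp; ring) m δ hδ hδ1
  set P := Fintype.piFinset (fun _ : Fin m => A) with hP
  have hsub : (P.filter (fun a => δ * m < |∑ i, f (a i) - m * h|)) ⊆
      (P.filter (fun a => δ * m < ∑ i, (f (a i) - h))) ∪
      (P.filter (fun a => δ * m < ∑ i, (h - f (a i)))) := by
    intro a ha
    rw [Finset.mem_filter] at ha
    rw [Finset.mem_union, Finset.mem_filter, Finset.mem_filter]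
    rcases lt_abs.1 ha.2 with h | h
    · left; refine ⟨ha.1, ?_⟩; simpa using h
    · right; refine ⟨ha.1, ?_⟩; simpa using h
  have := (Finset.card_le_card hsub).trans (Finset.card_union_le _ _)
  have : ((P.filter (fun a => δ * m < |∑ i, f (a i) - m * h|)).card : ℝ) ≤
      (P.filter (fun a => δ * m < ∑ i, (f (a i) - h))).card +
      (P.filter (fun a => δ * m < ∑ i, (h - f (a i)))).card := by exact_mod_cast this
  linarith

/-- iterated sumset -/
def ns {G : Type} [AddCommGroup G] [DecidableEq G] (X : Finset G) : ℕ → Finset G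
  | 0 => {0}
  | n + 1 => ns X n + X

section CS
variable {G : Type} [AddCommGroup G] [Fintype G] [DecidableEq G]

/-- number of exceptional points -/
noncomputable def exc (u v : G → ℝ) (ε : ℝ) : Finset G :=
  Finset.univ.filter (fun x => ε < |u x - v x|)

lemma exc_tri (u v w : G → ℝ) (ε₁ ε₂ : ℝ) :
    ((exc u w (ε₁ + ε₂)).card : ℝ) ≤ (exc u v ε₁).card + (exc v w ε₂).card := by
  have : exc u w (ε₁ + ε₂) ⊆ exc u v ε₁ ∪ exc v w ε₂ := by
    intro x hx
    simp only [exc, Finset.mem_filter, Finset.mem_univ, true_and, Finset.mem_union] at hx ⊢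
    by_contra! h
    have := abs_sub_le (u x) (v x) (w x)
    linarith
  exact_mod_cast (Finset.card_le_card this).trans (Finset.card_union_le _ _)

lemma exc_shift (u v : G → ℝ) (ε : ℝ) (t : G) :
    (exc (fun x => u (x + t)) (fun x => v (x + t)) ε).card = (exc u v ε).card := by
  refine Finset.card_bij (fun x _ => x + t) ?_ ?_ ?_
  · intro a ha; simpa [exc] using ha
  · intro a _ b _ h; simpa using h
  · intro b hb; exact ⟨b - t, by simpa [exc] using hb, by simp⟩

lemma exc_symm (u v : G → ℝ) (ε : ℝ) : exc u v ε = exc v u ε := by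
  ext x; simp [exc, abs_sub_comm]

lemma markov_half {α : Type} [DecidableEq α] (P : Finset α) (N : α → ℝ) (hN : ∀ a ∈ P, 0 ≤ N a) (c : ℝ)
    (hc : 0 < c) (h : ∑ a ∈ P, N a ≤ c / 2 * P.card) :
    (P.card : ℝ) ≤ 2 * (P.filter (fun a => N a ≤ c)).card := by
  have h1 : (P.card : ℝ) = (P.filter (fun a => N a ≤ c)).card + (P.filter (fun a => ¬ N a ≤ c)).card := by
    exact_mod_cast (Finset.card_filter_add_card_filter_not _).symm
  have h2 : c * (P.filter (fun a => ¬ N a ≤ c)).card ≤ ∑ a ∈ P, N a := by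
    rw [mul_comm, ← nsmul_eq_mul, ← Finset.sum_const]
    refine (Finset.sum_le_sum (g := N) ?_).trans
      (Finset.sum_le_sum_of_subset_of_nonneg (Finset.filter_subset _ _) ?_)
    · intro a ha; exact (not_le.1 (Finset.mem_filter.1 ha).2).le
    · intro a ha _; exact hN a ha
  have h3 : ((P.filter (fun a => ¬ N a ≤ c)).card : ℝ) ≤ P.card / 2 := by
    have := h2.trans h
    have : c * ((P.filter (fun a => ¬ N a ≤ c)).card : ℝ) ≤ c * (P.card / 2) := by linarith
    exact le_of_mul_le_mul_left this hc
  linarith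

lemma cs_pigeon (A T : Finset G) (hA : A.Nonempty) (hT : T.Nonempty) (m : ℕ)
    (Gd : Finset (Fin m → G)) (hGd : Gd ⊆ Fintype.piFinset (fun _ => A))
    (hc : (A.card : ℝ) ^ m ≤ 2 * Gd.card) :
    ∃ b : Fin m → G, (T.card : ℝ) * (A.card : ℝ) ^ m ≤
      2 * (T.filter (fun t => (fun i => b i - t) ∈ Gd)).card * ((A + T).card : ℝ) ^ m := by
  have hAT : (A + T).Nonempty := hA.add hT
  have hQ : (Fintype.piFinset (fun _ : Fin m => A + T)).Nonempty := by
    rw [Fintype.piFinset_nonempty]; exact fun _ => hAT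
  have hQc : ((Fintype.piFinset (fun _ : Fin m => A + T)).card : ℝ) = ((A + T).card : ℝ) ^ m := by
    simp [Fintype.card_piFinset]
  have hpos : (0 : ℝ) < ((A + T).card : ℝ) ^ m := by
    have : (0 : ℝ) < (A + T).card := by exact_mod_cast hAT.card_pos
    positivity
  obtain ⟨b, hb, hb2⟩ := Finset.exists_le_card_fiber_of_nsmul_le_card_of_maps_to
    (s := T ×ˢ Gd) (t := Fintype.piFinset (fun _ : Fin m => A + T))
    (f := fun p => fun i => p.2 i + p.1)
    (b := ((T.card : ℝ) * Gd.card) / ((A + T).card : ℝ) ^ m) (by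
      rintro ⟨t, a⟩ h
      rw [Finset.mem_product] at h
      rw [Fintype.mem_piFinset]
      intro i
      exact Finset.add_mem_add (Fintype.mem_piFinset.1 (hGd h.2) i) h.1) hQ (by
      rw [nsmul_eq_mul, hQc, Finset.card_product]
      push_cast
      rw [mul_div_cancel₀ _ hpos.ne'])
  refine ⟨b, ?_⟩
  have h1 : ((T ×ˢ Gd).filter (fun p => (fun i => p.2 i + p.1) = b)).card ≤
      (T.filter (fun t => (fun i => b i - t) ∈ Gd)).card := by
    refine Finset.card_le_card_of_injOn (fun p => p.1) ?_ ?_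
    · rintro ⟨t, a⟩ h
      simp only [Finset.coe_filter, Finset.mem_product, Set.mem_setOf_eq] at h ⊢
      refine ⟨h.1.1, ?_⟩
      rw [← h.2]; simpa using h.1.2
    · rintro ⟨t, a⟩ h ⟨t', a'⟩ h' e
      simp only [Finset.coe_filter, Finset.mem_product, Set.mem_setOf_eq] at h h' e
      subst e
      have := h.2.trans h'.2.symm
      have : a = a' := by
        funext i; simpa using congrFun this i
      rw [this]
  have h2 : ((T.card : ℝ) * Gd.card) / ((A + T).card : ℝ) ^ m ≤
      (T.filter (fun t => (fun i => b i - t) ∈ Gd)).card := hb2.trans (by exact_mod_cast h1)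
  rw [div_le_iff₀ hpos] at h2
  have h3 : (T.card : ℝ) * (A.card : ℝ) ^ m ≤ T.card * (2 * Gd.card) := by gcongr
  linarith

lemma croot_sisask (A S T : Finset G) (hA : A.Nonempty) (hS : S.Nonempty) (hT : T.Nonempty)
    (k m : ℕ) (hk : 1 ≤ k) (hm1 : 1 ≤ m)
    (hm : 4 * Real.exp (-(m / (64 * (k : ℝ) ^ 2))) * (S + A - A).card ≤ S.card / (4 * k)) :
    ∃ T' ⊆ T, T'.Nonempty ∧
      (T.card : ℝ) * (A.card : ℝ) ^ m ≤ 2 * T'.card * ((A + T).card : ℝ) ^ m ∧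
      ns (T' - T') k ⊆ (S + A) - (S + A) := by
  classical
  set B := S + A with hB
  set R := B - A with hR
  have hk0 : (1 : ℝ) ≤ k := by exact_mod_cast hk
  set δ : ℝ := 1 / (4 * k) with hδ
  have hδ0 : 0 < δ := by positivity
  have hδ1 : δ ≤ 1 := by
    rw [hδ, div_le_one (by positivity)]; linarith
  have hm0 : (0 : ℝ) < m := by exact_mod_cast hm1
  set ind : G → ℝ := fun x => if x ∈ B then 1 else 0 with hind
  have ind0 : ∀ x, 0 ≤ ind x := by intro x; simp only [hind]; split_ifs <;> norm_num
  have ind1 : ∀ x, ind x ≤ 1 := by intro x; simp only [hind]; split_ifs <;> norm_num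
  have hAc : (0 : ℝ) < A.card := by exact_mod_cast hA.card_pos
  have hSc : (0 : ℝ) < S.card := by exact_mod_cast hS.card_pos
  set h : G → ℝ := fun x => (∑ a ∈ A, ind (x + a)) / A.card with hh
  set s : (Fin m → G) → G → ℝ := fun b x => (∑ i, ind (x + b i)) / m with hs
  set P := Fintype.piFinset (fun _ : Fin m => A) with hP
  have hPc : (P.card : ℝ) = (A.card : ℝ) ^ m := by simp [hP, Fintype.card_piFinset]
  -- off `R` there are no exceptional points
  have hoff : ∀ a ∈ P, exc (s a) h δ ⊆ R := by
    intro a ha x hx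
    by_contra hxR
    have hz : ∀ y ∈ A, ind (x + y) = 0 := by
      intro y hy
      simp only [hind]
      rw [if_neg]
      intro hxy
      apply hxR
      rw [hR]
      have := Finset.sub_mem_sub hxy hy
      simpa using this
    have h1 : s a x = 0 := by
      simp only [hs]
      rw [Finset.sum_eq_zero, zero_div]
      intro i _
      exact hz _ (Fintype.mem_piFinset.1 ha i)
    have h2 : h x = 0 := by
      simp only [hh]
      rw [Finset.sum_eq_zero hz, zero_div]
    simp only [exc, Finset.mem_filter, h1, h2] at hx
    simp at hx
    linarith
  have hcount : ∑ a ∈ P, ((exc (s a) h δ).card : ℝ) ≤ (δ * S.card) / 2 * P.card := by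
    have e1 : ∀ a ∈ P, ((exc (s a) h δ).card : ℝ) =
        ∑ x ∈ R, if δ * m < |∑ i, ind (x + a i) - m * h x| then (1 : ℝ) else 0 := by
      intro a ha
      rw [← Finset.sum_filter, Finset.sum_const, nsmul_eq_mul, mul_one]
      congr 2
      ext x
      constructor
      · intro hx
        rw [Finset.mem_filter]
        refine ⟨hoff a ha hx, ?_⟩
        have hx' : δ < |s a x - h x| := by simpa [exc] using hx
        have : ∑ i, ind (x + a i) - m * h x = (s a x - h x) * m := by
          simp only [hs]; field_simp
        rw [this, abs_mul, abs_of_pos hm0]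
        gcongr
      · intro hx
        rw [Finset.mem_filter] at hx
        have hx' := hx.2
        have : ∑ i, ind (x + a i) - m * h x = (s a x - h x) * m := by
          simp only [hs]; field_simp
        rw [this, abs_mul, abs_of_pos hm0] at hx'
        simpa [exc] using lt_of_mul_lt_mul_right hx' hm0.le
    rw [Finset.sum_congr rfl e1, Finset.sum_comm]
    have e2 : ∀ x ∈ R, ∑ a ∈ P, (if δ * m < |∑ i, ind (x + a i) - m * h x| then (1 : ℝ) else 0)
        ≤ 2 * Real.exp (-(δ ^ 2 * m / 4)) * (A.card : ℝ) ^ m := by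
      intro x _
      rw [← Finset.sum_filter, Finset.sum_const, nsmul_eq_mul, mul_one]
      refine chernoff A hA (fun a => ind (x + a)) (fun a _ => ind0 _) (fun a _ => ind1 _) (h x) ?_
        m δ hδ0 hδ1
      simp only [hh]; field_simp
    refine (Finset.sum_le_sum e2).trans ?_
    rw [Finset.sum_const, nsmul_eq_mul, hPc]
    have e3 : δ ^ 2 * m / 4 = m / (64 * (k : ℝ) ^ 2) := by rw [hδ]; field_simp; norm_num
    rw [e3]
    have e4 : S.card / (4 * (k : ℝ)) = δ * S.card := by rw [hδ]; field_simp
    rw [e4] at hm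
    have : (0 : ℝ) ≤ (A.card : ℝ) ^ m := by positivity
    nlinarith
  set Gd := P.filter (fun a => ((exc (s a) h δ).card : ℝ) ≤ δ * S.card) with hGd
  have hGdc := markov_half P (fun a => ((exc (s a) h δ).card : ℝ)) (fun _ _ => by positivity)
    (δ * S.card) (by positivity) hcount
  rw [hPc] at hGdc
  obtain ⟨b, hb⟩ := cs_pigeon A T hA hT m Gd (Finset.filter_subset _ _) hGdc
  set T' := T.filter (fun t => (fun i => b i - t) ∈ Gd) with hT'
  have hT'ne : T'.Nonempty := by
    rw [Finset.nonempty_iff_ne_empty]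
    intro h0
    rw [h0] at hb
    have : (0 : ℝ) < T.card := by exact_mod_cast hT.card_pos
    have : (0 : ℝ) < (T.card : ℝ) * (A.card : ℝ) ^ m := by positivity
    simp at hb
    linarith
  refine ⟨T', Finset.filter_subset _ _, hT'ne, hb, ?_⟩
  have hgood : ∀ t ∈ T', ((exc (s b) (fun x => h (x + t)) δ).card : ℝ) ≤ δ * S.card := by
    intro t ht
    have h1 := (Finset.mem_filter.1 (Finset.mem_filter.1 ht).2).2
    rw [← exc_shift _ _ _ t] at h1
    have : (fun x => s (fun i => b i - t) (x + t)) = s b := by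
      funext x
      simp only [hs]
      congr 1
      refine Finset.sum_congr rfl (fun i _ => ?_)
      congr 1; abel
    rwa [this] at h1
  have hpair : ∀ t ∈ T', ∀ t' ∈ T',
      ((exc (fun x => h (x + t)) (fun x => h (x + t')) (δ + δ)).card : ℝ) ≤ 2 * (δ * S.card) := by
    intro t ht t' ht'
    have h1 := hgood t ht
    rw [exc_symm] at h1
    have := exc_tri (fun x => h (x + t)) (s b) (fun x => h (x + t')) δ δ
    have := hgood t' ht'
    linarith
  have hchain : ∀ n : ℕ, ∀ y ∈ ns (T' - T') n,
      ((exc (fun x => h (x + y)) h (n * (δ + δ))).card : ℝ) ≤ n * (2 * (δ * S.card)) := by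
    intro n
    induction n with
    | zero =>
      intro y hy
      simp only [ns, Finset.mem_singleton] at hy
      subst hy
      simp [exc]
    | succ n ih =>
      intro y hy
      rw [ns, Finset.mem_add] at hy
      obtain ⟨y0, hy0, z, hz, rfl⟩ := hy
      obtain ⟨t, ht, t', ht', rfl⟩ := Finset.mem_sub.1 hz
      have h1 := hpair t ht t' ht'
      rw [← exc_shift _ _ _ (y0 - t')] at h1
      have h2 := exc_tri (fun x => h (x + (y0 + (t - t')))) (fun x => h (x + y0)) h (δ + δ)
        (n * (δ + δ))
      have h3 := ih y0 hy0
      have e1 : (fun x => h (x + (y0 - t') + t)) = (fun x => h (x + (y0 + (t - t')))) := by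
        funext x; congr 1; abel
      have e2 : (fun x => h (x + (y0 - t') + t')) = (fun x => h (x + y0)) := by
        funext x; congr 1; abel
      rw [e1, e2] at h1
      have e3 : ((n + 1 : ℕ) : ℝ) * (δ + δ) = (δ + δ) + n * (δ + δ) := by push_cast; ring
      rw [e3]
      push_cast
      linarith
  intro y hy
  have h1 := hchain k y hy
  have e1 : (k : ℝ) * (δ + δ) = 1 / 2 := by rw [hδ]; field_simp; norm_num
  have e2 : (k : ℝ) * (2 * (δ * S.card)) = S.card / 2 := by rw [hδ]; field_simp; norm_num
  rw [e1, e2] at h1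
  have : ∃ x ∈ S, x ∉ exc (fun x => h (x + y)) h (1 / 2) := by
    by_contra! hcon
    have : (S.card : ℝ) ≤ (exc (fun x => h (x + y)) h (1 / 2)).card := by
      exact_mod_cast Finset.card_le_card hcon
    linarith
  obtain ⟨x, hxS, hx⟩ := this
  have hx1 : h x = 1 := by
    simp only [hh]
    rw [div_eq_one_iff_eq hAc.ne']
    rw [Finset.sum_congr rfl (g := fun _ => (1 : ℝ))]
    · simp
    · intro a ha
      simp only [hind]
      rw [if_pos]
      exact Finset.add_mem_add hxS ha
  have hx2 : |h (x + y) - 1| ≤ 1 / 2 := by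
    simpa [exc, hx1] using hx
  have hx3 : 0 < h (x + y) := by
    have := (abs_le.1 hx2).1; linarith
  have : ∃ a ∈ A, x + y + a ∈ B := by
    by_contra! hcon
    have : h (x + y) = 0 := by
      simp only [hh]
      rw [Finset.sum_eq_zero, zero_div]
      intro a ha
      simp only [hind]
      rw [if_neg (hcon a ha)]
    linarith
  obtain ⟨a, ha, hxa⟩ := this
  rw [Finset.mem_sub]
  exact ⟨x + y + a, hxa, x + a, Finset.add_mem_add hxS ha, by abel⟩

end CS

section NS
variable {G : Type} [AddCommGroup G] [DecidableEq G]

lemma ns_one (X : Finset G) : ns X 1 = X := by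
  simp [ns, Finset.singleton_zero]

lemma ns_add (X : Finset G) (m n : ℕ) : ns X (m + n) = ns X m + ns X n := by
  induction n with
  | zero => simp [ns, Finset.singleton_zero]
  | succ n ih => rw [← add_assoc, ns, ih, ns, add_assoc]

lemma ns_mul (X : Finset G) (m n : ℕ) : ns (ns X m) n = ns X (m * n) := by
  induction n with
  | zero => simp [ns, Finset.singleton_zero]
  | succ n ih => rw [ns, ih, Nat.mul_succ, ns_add]

lemma ns_mono {X Y : Finset G} (h : X ⊆ Y) (n : ℕ) : ns X n ⊆ ns Y n := by
  induction n with
  | zero => simp [ns, Finset.singleton_zero]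
  | succ n ih => rw [ns, ns]; exact Finset.add_subset_add ih h

lemma zero_mem_ns {X : Finset G} (h : (0 : G) ∈ X) (n : ℕ) : (0 : G) ∈ ns X n := by
  induction n with
  | zero => simp [ns, Finset.singleton_zero]
  | succ n ih => rw [ns]; simpa using Finset.add_mem_add ih h

lemma ns_le {X : Finset G} (h : (0 : G) ∈ X) {m n : ℕ} (hmn : m ≤ n) : ns X m ⊆ ns X n := by
  obtain ⟨d, rfl⟩ := Nat.exists_eq_add_of_le hmn
  rw [ns_add]
  intro x hx
  simpa using Finset.add_mem_add hx (zero_mem_ns h d)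

lemma ns_neg {X : Finset G} (h : -X = X) (n : ℕ) : -(ns X n) = ns X n := by
  induction n with
  | zero => simp [ns, Finset.singleton_zero]
  | succ n ih => rw [ns, neg_add, ih, h]

lemma card_le_add_left (X Y : Finset G) (hY : Y.Nonempty) : X.card ≤ (X + Y).card :=
  Finset.card_le_card_add_right hY

lemma petridis (A B : Finset G) (hA : A.Nonempty) (c : ℝ) (hc : ((A + B).card : ℝ) ≤ c * A.card) :
    ∃ A1 ⊆ A, A1.Nonempty ∧ ∀ C : Finset G, ((C + A1 + B).card : ℝ) ≤ c * (C + A1).card := by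
  obtain ⟨A1, hA1, hmin⟩ := Finset.exists_min_image (A.powerset.filter (fun s => s.Nonempty))
    (fun s => ((s + B).card : ℝ) / s.card) ⟨A, by simp [hA]⟩
  rw [Finset.mem_filter, Finset.mem_powerset] at hA1
  refine ⟨A1, hA1.1, hA1.2, fun C => ?_⟩
  have hp1 : (0 : ℝ) < A1.card := by exact_mod_cast hA1.2.card_pos
  have hp : (0 : ℝ) < A.card := by exact_mod_cast hA.card_pos
  have h1 := Finset.pluennecke_petridis_inequality_add (A := A1) (B := B) C (by
    intro A' hA'
    rcases A'.eq_empty_or_nonempty with rfl | hne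
    · simp
    · have := hmin A' (by simp [hne, hA'.trans hA1.1])
      have hp' : (0 : ℝ) < A'.card := by exact_mod_cast hne.card_pos
      rw [div_le_div_iff₀ hp1 hp'] at this
      exact_mod_cast this)
  have h2 := hmin A (by simp [hA])
  have h3 : ((A + B).card : ℝ) / A.card ≤ c := by rwa [div_le_iff₀ hp]
  have h4 := h2.trans h3
  rw [div_le_iff₀ hp1] at h4
  have h1' : ((C + A1 + B).card : ℝ) * A1.card ≤ (A1 + B).card * (C + A1).card := by exact_mod_cast h1
  have h5 : ((A1 + B).card : ℝ) * (C + A1).card ≤ c * A1.card * (C + A1).card := by gcongr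
  refine le_of_mul_le_mul_right ?_ hp1
  linarith

lemma growth_pigeon (f : ℕ → ℝ) (k : ℕ) (hk : 1 ≤ k) (κ : ℝ)
    (h : f k ≤ Real.exp κ * f 0) : ∃ j < k, f (j + 1) ≤ Real.exp (κ / k) * f j := by
  by_contra! hcon
  have hk0 : (k : ℝ) ≠ 0 := by positivity
  have : ∀ j, j + 1 ≤ k → Real.exp (κ / k) ^ (j + 1) * f 0 < f (j + 1) := by
    intro j
    induction j with
    | zero => intro hj; simpa using hcon 0 (by omega)
    | succ j ih =>
      intro hj
      have h1 := ih (by omega)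
      have h2 := hcon (j + 1) (by omega)
      rw [pow_succ' _ (j + 1), mul_assoc]
      refine lt_trans ?_ h2
      gcongr
  have h1 := this (k - 1) (by omega)
  rw [Nat.sub_add_cancel hk, ← Real.exp_nat_mul, mul_div_cancel₀ _ hk0] at h1
  linarith

lemma growth_pluen (A B : Finset G) (hA : A.Nonempty) (κ : ℝ)
    (h : ((A + B).card : ℝ) ≤ Real.exp κ * A.card) (n : ℕ) :
    ((ns B n).card : ℝ) ≤ Real.exp (κ * n) * A.card := by
  obtain ⟨A1, hsub, hne, hP⟩ := petridis A B hA _ h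
  have : ∀ n : ℕ, ((A1 + ns B n).card : ℝ) ≤ Real.exp (κ * n) * A1.card := by
    intro n
    induction n with
    | zero => simp [ns, Finset.singleton_zero]
    | succ n ih =>
      have h1 := hP (ns B n)
      rw [ns, ← add_assoc, add_comm A1]
      have h2 : Real.exp κ * ((ns B n + A1).card : ℝ) ≤ Real.exp κ * (Real.exp (κ * n) * A1.card) := by
        rw [add_comm]; gcongr
      refine (h1.trans h2).trans (le_of_eq ?_)
      rw [← mul_assoc, ← Real.exp_add]; push_cast; ring_nf
  have h1 : ((ns B n).card : ℝ) ≤ (A1 + ns B n).card := by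
    rw [add_comm]; exact_mod_cast card_le_add_left _ _ hne
  have h2 : (A1.card : ℝ) ≤ A.card := by exact_mod_cast Finset.card_le_card hsub
  calc _ ≤ _ := h1
    _ ≤ _ := this n
    _ ≤ _ := by gcongr

end NS

section Iter
variable {G : Type} [AddCommGroup G] [Fintype G] [DecidableEq G]

lemma iter_step (A D X : Finset G) (hA : A.Nonempty) (hD : A - A ⊆ D)
    (hX : -X = X) (hX0 : (0 : G) ∈ X) (q κ : ℝ)
    (hq : ∀ C : Finset G, ((C + A + D).card : ℝ) ≤ Real.exp q * (C + A).card)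
    (k k' m : ℕ) (hk : 1 ≤ k) (hk' : 1 ≤ k') (hm1 : 1 ≤ m)
    (hκ : ((A + ns X (2 * k)).card : ℝ) ≤ Real.exp κ * A.card)
    (hm : 256 * (k' : ℝ) ^ 2 * (q + κ + Real.log (32 * k')) ≤ m) :
    ∃ X' : Finset G, -X' = X' ∧ (0 : G) ∈ X' ∧
      ((A + ns X' (2 * k')).card : ℝ) ≤ Real.exp (κ + 2 * q) * A.card ∧
      (X.card : ℝ) ≤ 2 * Real.exp (m * κ / k) * X'.card := by
  have hXne : X.Nonempty := ⟨0, hX0⟩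
  obtain ⟨j, hj, hj2⟩ := growth_pigeon (fun j => ((A + ns X j).card : ℝ)) k hk κ (by
    have : ((A + ns X k).card : ℝ) ≤ (A + ns X (2 * k)).card := by
      exact_mod_cast Finset.card_le_card (Finset.add_subset_add_left (ns_le hX0 (by omega)))
    simpa [ns, Finset.singleton_zero] using this.trans hκ)
  set Y := ns X j with hY
  have hYs : -Y = Y := ns_neg hX j
  have hYY : ((A + (Y + Y)).card : ℝ) ≤ Real.exp κ * A.card := by
    have : ((A + (Y + Y)).card : ℝ) ≤ (A + ns X (2 * k)).card := by
      rw [hY, ← ns_add]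
      exact_mod_cast Finset.card_le_card (Finset.add_subset_add_left (ns_le hX0 (by omega)))
    exact this.trans hκ
  have hAY : (A + Y).Nonempty := hA.add ⟨0, zero_mem_ns hX0 j⟩
  have hk'0 : (1 : ℝ) ≤ k' := by exact_mod_cast hk'
  have hRsub : A + (A + Y) - (A + Y) ⊆ Y + Y + A + D := by
    have : A + (A + Y) - (A + Y) = (Y + -Y) + A + (A - A) := by
      simp only [sub_eq_add_neg, neg_add]; ac_rfl
    rw [this, hYs]
    exact Finset.add_subset_add_left hD
  have hR : ((A + (A + Y) - (A + Y)).card : ℝ) ≤ Real.exp (q + κ) * A.card := by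
    have h1 : ((A + (A + Y) - (A + Y)).card : ℝ) ≤ (Y + Y + A + D).card := by
      exact_mod_cast Finset.card_le_card hRsub
    have h2 := hq (Y + Y)
    rw [add_comm _ A] at h2 h1
    calc _ ≤ _ := h1
      _ ≤ _ := h2
      _ ≤ Real.exp q * (Real.exp κ * A.card) := by gcongr
      _ = _ := by rw [Real.exp_add]; ring
  have hA0 : (0 : ℝ) < A.card := by exact_mod_cast hA.card_pos
  obtain ⟨T', hT'X, hT'ne, hT'c, hT'ns⟩ := croot_sisask (A + Y) A X hAY hA hXne (2 * k') m
    (by omega) hm1 (by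
      have e1 : (64 * ((2 * k' : ℕ) : ℝ) ^ 2) = 256 * (k' : ℝ) ^ 2 := by push_cast; ring
      have e2 : (4 * ((2 * k' : ℕ) : ℝ)) = 8 * k' := by push_cast; ring
      rw [e1, e2]
      have h1 : q + κ + Real.log (32 * k') ≤ m / (256 * (k' : ℝ) ^ 2) := by
        rw [le_div_iff₀ (by positivity)]; linarith
      have h2 : Real.exp (-(m / (256 * (k' : ℝ) ^ 2))) ≤
          Real.exp (-(q + κ + Real.log (32 * k'))) := by gcongr
      have h3 : Real.exp (-(q + κ + Real.log (32 * k'))) * Real.exp (q + κ) = (32 * (k' : ℝ))⁻¹ := by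
        rw [← Real.exp_add]
        have : -(q + κ + Real.log (32 * k')) + (q + κ) = - Real.log (32 * k') := by ring
        rw [this, Real.exp_neg, Real.exp_log (by positivity)]
      calc _ ≤ 4 * Real.exp (-(q + κ + Real.log (32 * k'))) * (Real.exp (q + κ) * A.card) := by
            gcongr
        _ = 4 * (Real.exp (-(q + κ + Real.log (32 * k'))) * Real.exp (q + κ)) * A.card := by ring
        _ = A.card / (8 * k') := by rw [h3]; field_simp; norm_num
        _ ≤ _ := le_rfl)
  refine ⟨T' - T', by simp, ?_, ?_, ?_⟩
  · obtain ⟨t, ht⟩ := hT'ne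
    simpa using Finset.sub_mem_sub ht ht
  · have hsub : A + ns (T' - T') (2 * k') ⊆ (Y + Y + D) + A + D := by
      refine (Finset.add_subset_add_left hT'ns).trans ?_
      have : A + (A + (A + Y) - (A + (A + Y))) = (Y + -Y + (A - A)) + A + (A - A) := by
        simp only [sub_eq_add_neg, neg_add]; ac_rfl
      rw [this, hYs]
      exact Finset.add_subset_add (Finset.add_subset_add_right (Finset.add_subset_add_left hD)) hD
    have h1 : ((A + ns (T' - T') (2 * k')).card : ℝ) ≤ ((Y + Y + D) + A + D).card := by
      exact_mod_cast Finset.card_le_card hsub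
    have h2 := hq (Y + Y + D)
    have h3 := hq (Y + Y)
    rw [add_right_comm, add_comm (Y + Y) A] at h3
    rw [add_right_comm (Y + Y) D A, add_comm (Y + Y) A] at h1 h2
    rw [add_right_comm] at h3
    calc _ ≤ _ := h1
      _ ≤ _ := h2
      _ ≤ Real.exp q * (Real.exp q * (A + (Y + Y)).card) := by
          gcongr
          refine le_trans (le_of_eq ?_) h3
          congr 2
          ac_rfl
      _ ≤ Real.exp q * (Real.exp q * (Real.exp κ * A.card)) := by gcongr
      _ = _ := by
        rw [show κ + 2 * q = q + (q + κ) by ring, Real.exp_add, Real.exp_add]; ring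
  · have hp : (0 : ℝ) < (A + Y).card := by exact_mod_cast hAY.card_pos
    rw [ns, ← add_assoc] at hj2
    have h1 : ((A + Y + X).card : ℝ) ^ m ≤ (Real.exp (κ / k) * (A + Y).card) ^ m := by gcongr
    have h2 : (T'.card : ℝ) ≤ (T' - T').card := by
      have : T' - T' = T' + -T' := sub_eq_add_neg _ _
      rw [this]
      exact_mod_cast card_le_add_left _ _ hT'ne.neg
    rw [mul_pow, ← Real.exp_nat_mul] at h1
    have h3 : (X.card : ℝ) * ((A + Y).card : ℝ) ^ m ≤
        (2 * Real.exp (m * κ / k) * (T' - T').card) * ((A + Y).card : ℝ) ^ m := by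
      calc _ ≤ _ := hT'c
        _ ≤ 2 * (T' - T').card * (Real.exp (m * (κ / k)) * ((A + Y).card : ℝ) ^ m) := by gcongr
        _ = _ := by rw [mul_div_assoc]; ring
    exact le_of_mul_le_mul_right h3 (by positivity)

lemma iter_all (A D : Finset G) (hA : A.Nonempty) (hD : A - A ⊆ D) (hDs : -D = D)
    (hD0 : (0 : G) ∈ D) (q : ℝ)
    (hq : ∀ C : Finset G, ((C + A + D).card : ℝ) ≤ Real.exp q * (C + A).card)
    (k m : ℕ → ℕ) (hk0 : k 0 = 1) (hk : ∀ i, 1 ≤ k i) (hm1 : ∀ i, 1 ≤ m i)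
    (hm : ∀ i, 256 * (k (i + 1) : ℝ) ^ 2 *
      (q + 2 * q * (i + 1) + Real.log (32 * k (i + 1))) ≤ m i) (N : ℕ) :
    ∃ X : Finset G, -X = X ∧ (0 : G) ∈ X ∧
      ((A + ns X (2 * k N)).card : ℝ) ≤ Real.exp (2 * q * (N + 1)) * A.card ∧
      (A.card : ℝ) ≤ Real.exp (∑ i ∈ Finset.range N, (Real.log 2 + m i * (2 * q * (i + 1)) / k i))
        * X.card := by
  induction N with
  | zero =>
    refine ⟨D, hDs, hD0, ?_, ?_⟩
    · rw [hk0]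
      have h1 := hq 0
      have h2 := hq D
      rw [zero_add] at h1
      rw [add_comm D A] at h2
      have e : A + ns D (2 * 1) = A + D + D := by simp [ns, Finset.singleton_zero, add_assoc]
      rw [e]
      calc _ ≤ _ := h2
        _ ≤ Real.exp q * (Real.exp q * A.card) := by gcongr
        _ = _ := by rw [← mul_assoc, ← Real.exp_add]; norm_num; left; ring
    · simp
      refine le_trans ?_ (Finset.card_le_card hD)
      rw [sub_eq_add_neg]
      exact card_le_add_left _ _ hA.neg
  | succ N ih =>
    obtain ⟨X, hXs, hX0, h1, h2⟩ := ih
    obtain ⟨X', hXs', hX0', h1', h2'⟩ := iter_step A D X hA hD hXs hX0 q _ hq (k N) (k (N + 1)) (m N)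
      (hk _) (hk _) (hm1 _) h1 (hm N)
    refine ⟨X', hXs', hX0', ?_, ?_⟩
    · refine h1'.trans (le_of_eq ?_)
      push_cast; ring_nf
    · rw [Finset.sum_range_succ, Real.exp_add, Real.exp_add, Real.exp_log (by norm_num)]
      calc _ ≤ _ := h2
        _ ≤ Real.exp (∑ i ∈ Finset.range N, (Real.log 2 + m i * (2 * q * (i + 1)) / k i)) *
          (2 * Real.exp (m N * (2 * q * (N + 1)) / k N) * X'.card) := by gcongr
        _ = _ := by ring

end Iter

lemma cube_le (t : ℕ) : ((t : ℝ) + 11) ^ 3 ≤ 1331 * 2 ^ t := by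
  induction t with
  | zero => norm_num
  | succ t ih =>
    rw [pow_succ 2 t]
    push_cast
    have : ((t : ℝ) + 1 + 11) ^ 3 ≤ 2 * ((t : ℝ) + 11) ^ 3 := by
      have : (0 : ℝ) ≤ t := by positivity
      nlinarith [mul_nonneg this this, mul_nonneg this (mul_nonneg this this)]
    linarith

lemma kseq_sq (n i : ℕ) : (2 ^ (n - n / 2 ^ (i + 1)) : ℕ) ^ 2 ≤ 2 ^ (n + 1) * 2 ^ (n - n / 2 ^ i) := by
  rw [← pow_mul, ← pow_add]
  apply Nat.pow_le_pow_right (by norm_num)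
  have h1 : n / 2 ^ (i + 1) = n / 2 ^ i / 2 := by rw [pow_succ, Nat.div_div_eq_div_mul]
  have h2 : n / 2 ^ i ≤ n := Nat.div_le_self _ _
  rw [h1]
  omega

section
variable {G : Type} [AddCommGroup G] [Fintype G] [DecidableEq G]

lemma iter_final (A D : Finset G) (hA : A.Nonempty) (hD : A - A ⊆ D) (hDs : -D = D)
    (hD0 : (0 : G) ∈ D) (L : ℝ) (hL : 1 / 2 ≤ L)
    (hq : ∀ C : Finset G, ((C + A + D).card : ℝ) ≤ Real.exp (3 * L) * (C + A).card)
    (n0 : ℕ) (hn0 : 1 ≤ n0) (h1 : 2 * L ≤ 2 ^ n0) (h2 : (2 : ℝ) ^ n0 ≤ 4 * L) :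
    ∃ (X : Finset G) (l : ℕ) (κ Dt : ℝ), -X = X ∧ (0 : G) ∈ X ∧ 0 ≤ κ ∧ 0 ≤ Dt ∧
      κ ≤ 66 * L * n0 ∧ Dt ≤ 2 ^ 50 * L ^ 3 * n0 ^ 2 ∧ 12 * κ + 12 ≤ l ∧
      ((A + ns X l).card : ℝ) ≤ Real.exp κ * A.card ∧
      (A.card : ℝ) ≤ Real.exp Dt * X.card := by
  obtain ⟨t, ht1, ht2⟩ : ∃ t, 2 ^ t ≤ n0 ∧ n0 < 2 ^ (t + 1) :=
    ⟨Nat.log 2 n0, Nat.pow_log_le_self 2 (by omega), Nat.lt_pow_succ_log_self (by norm_num) _⟩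
  have ht3 : t < 2 ^ t := Nat.lt_two_pow_self
  obtain ⟨N, hN⟩ : ∃ N, N = t + 10 := ⟨_, rfl⟩
  obtain ⟨n, hn⟩ : ∃ n, n = n0 + N + 7 := ⟨_, rfl⟩
  have hN1 : n < 2 ^ N := by
    rw [hN, pow_add]; rw [pow_succ] at ht2; omega
  obtain ⟨k, hk⟩ : ∃ k : ℕ → ℕ, ∀ i, k i = 2 ^ (n - n / 2 ^ i) := ⟨_, fun _ => rfl⟩
  have hkN : k N = 2 ^ n := by rw [hk, Nat.div_eq_of_lt hN1]; simp
  have hk1 : ∀ i, 1 ≤ k i := fun i => by rw [hk]; exact Nat.one_le_two_pow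
  have hkn : ∀ i, (k i : ℝ) ≤ 2 ^ n := by
    intro i
    have : k i ≤ 2 ^ n := by
      rw [hk]; exact Nat.pow_le_pow_right (by norm_num) (Nat.sub_le _ _)
    exact_mod_cast this
  have hksq : ∀ i, (k (i + 1) : ℝ) ^ 2 ≤ 2 ^ (n + 1) * k i := by
    intro i
    rw [hk, hk]
    exact_mod_cast kseq_sq n i
  have hlogpos : ∀ i, 0 < Real.log (32 * k i) := by
    intro i
    apply Real.log_pos
    have : (1 : ℝ) ≤ k i := by exact_mod_cast hk1 i
    linarith
  have hlog : ∀ i, Real.log (32 * k i) ≤ n + 5 := by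
    intro i
    have : (32 : ℝ) * k i ≤ 2 ^ (n + 5) := by
      rw [pow_add]; have := hkn i; linarith
    have h3 : Real.log (32 * k i) ≤ Real.log (2 ^ (n + 5)) :=
      Real.log_le_log (by have : (1 : ℝ) ≤ k i := by exact_mod_cast hk1 i
                          linarith) this
    rw [Real.log_pow] at h3
    have := Real.log_two_lt_d9
    have h4 : ((n + 5 : ℕ) : ℝ) * Real.log 2 ≤ ((n + 5 : ℕ) : ℝ) * 1 := by gcongr; linarith
    push_cast at h3 h4
    linarith
  obtain ⟨w, hw⟩ : ∃ w : ℕ → ℝ, ∀ i, w i = 256 * (k (i + 1) : ℝ) ^ 2 *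
      (3 * L + 2 * (3 * L) * (i + 1) + Real.log (32 * k (i + 1))) := ⟨_, fun _ => rfl⟩
  obtain ⟨m, hm⟩ : ∃ m : ℕ → ℕ, ∀ i, m i = ⌈w i⌉₊ := ⟨_, fun _ => rfl⟩
  have hwpos : ∀ i, 0 < w i := by
    intro i
    have := hlogpos (i + 1)
    have : (0 : ℝ) < k (i + 1) := by exact_mod_cast hk1 (i + 1)
    rw [hw]; positivity
  obtain ⟨X, hXs, hX0, hX1, hX2⟩ := iter_all A D hA hD hDs hD0 (3 * L) hq k m
    (by simp [hk]) hk1 (fun i => by rw [hm]; exact Nat.one_le_ceil_iff.2 (hwpos i))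
    (fun i => by rw [hm, ← hw]; exact Nat.le_ceil _) N
  have hNR : (N : ℝ) + 1 = t + 11 := by rw [hN]; push_cast; ring
  have htR : (2 : ℝ) ^ t ≤ n0 := by exact_mod_cast ht1
  have hn0R : (n0 : ℝ) ≤ 4 * L := by
    have : (n0 : ℝ) ≤ 2 ^ n0 := by exact_mod_cast (Nat.lt_two_pow_self).le
    linarith
  have hn01 : (1 : ℝ) ≤ n0 := by exact_mod_cast hn0
  have h2n : (2 : ℝ) ^ n ≤ 2 ^ 19 * L * n0 := by
    rw [hn, hN, pow_add, pow_add, pow_add]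
    calc (2 : ℝ) ^ n0 * (2 ^ t * 2 ^ 10) * 2 ^ 7 ≤ (4 * L) * (n0 * 2 ^ 10) * 2 ^ 7 := by gcongr
      _ = _ := by ring
  have hM1 : (1 : ℝ) ≤ N + 1 := by have : (0 : ℝ) ≤ N := by positivity
                                   linarith
  have hE : 2 * (3 * L) * (N + 1) + n + 5 ≤ 34 * L * (N + 1) := by
    have : (n : ℝ) = n0 + N + 7 := by rw [hn]; push_cast; ring
    rw [this]
    nlinarith
  have hterm : ∀ i ∈ Finset.range N, Real.log 2 + m i * (2 * (3 * L) * (i + 1)) / k i ≤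
      1 + 2 ^ 10 * 2 ^ n * (34 * L * (N + 1)) ^ 2 := by
    intro i hi
    have hi' : (i : ℝ) + 1 ≤ N := by exact_mod_cast Finset.mem_range.1 hi
    have hkp : (1 : ℝ) ≤ k i := by exact_mod_cast hk1 i
    have hl2 : Real.log 2 ≤ 1 := by have := Real.log_two_lt_d9; linarith
    have hw1 : w i ≤ 256 * (2 ^ (n + 1) * k i) * (34 * L * (N + 1)) := by
      rw [hw]
      have := hksq i
      have h5 : 3 * L + 2 * (3 * L) * (i + 1) + Real.log (32 * k (i + 1)) ≤ 34 * L * (N + 1) := by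
        have := hlog (i + 1)
        nlinarith
      have := hlogpos (i + 1)
      gcongr
    have hone : (1 : ℝ) ≤ 256 * (2 ^ (n + 1) * k i) * (34 * L * (N + 1)) := by
      have a1 : (1 : ℝ) ≤ 2 ^ (n + 1) := one_le_pow₀ (by norm_num)
      have a2 : (1 : ℝ) ≤ 2 ^ (n + 1) * k i := one_le_mul_of_one_le_of_one_le a1 hkp
      have a3 : (1 : ℝ) ≤ 34 * L * (N + 1) :=
        one_le_mul_of_one_le_of_one_le (by linarith) hM1
      exact one_le_mul_of_one_le_of_one_le (by linarith) a3
    have hmi : (m i : ℝ) ≤ 2 * (256 * (2 ^ (n + 1) * k i) * (34 * L * (N + 1))) := by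
      have := (Nat.ceil_lt_add_one (hwpos i).le).le
      rw [hm]
      linarith
    have h6 : 2 * (3 * L) * (i + 1) ≤ 34 * L * (N + 1) := by nlinarith
    have h7 : m i * (2 * (3 * L) * (i + 1)) / k i ≤ 2 ^ 10 * 2 ^ n * (34 * L * (N + 1)) ^ 2 := by
      rw [div_le_iff₀ (by linarith)]
      calc _ ≤ 2 * (256 * (2 ^ (n + 1) * k i) * (34 * L * (N + 1))) * (34 * L * (N + 1)) := by gcongr
        _ = _ := by rw [pow_succ]; ring
    linarith
  have hsum := Finset.sum_le_sum hterm
  rw [Finset.sum_const, Finset.card_range, nsmul_eq_mul] at hsum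
  refine ⟨X, 2 * k N, 2 * (3 * L) * (N + 1), 2 ^ 50 * L ^ 3 * n0 ^ 2, hXs, hX0, by positivity,
    by positivity, ?_, le_rfl, ?_, hX1, ?_⟩
  · have : (t : ℝ) + 1 ≤ n0 := by exact_mod_cast (Nat.succ_le_of_lt ht3).trans ht1
    rw [hNR]
    nlinarith
  · have e : ((2 * k N : ℕ) : ℝ) = 2 ^ n0 * (2 ^ N * 2 ^ 8) := by
      rw [hkN, hn]; push_cast; rw [pow_add, pow_add]; ring
    rw [e]
    have h8 : (N : ℝ) + 1 ≤ 2 ^ N := by exact_mod_cast Nat.lt_two_pow_self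
    have h9 : (2 * L) * ((N + 1) * 2 ^ 8) ≤ (2 : ℝ) ^ n0 * (2 ^ N * 2 ^ 8) := by gcongr
    nlinarith
  · refine hX2.trans ?_
    have hS : ∑ i ∈ Finset.range N, (Real.log 2 + m i * (2 * (3 * L) * (i + 1)) / k i)
        ≤ 2 ^ 50 * L ^ 3 * n0 ^ 2 := by
      have hcube := cube_le t
      rw [← hNR] at hcube
      have hcube2 : ((N : ℝ) + 1) ^ 3 ≤ 1331 * n0 := by linarith
      have hL3 : 1 ≤ 8 * L ^ 3 := by
        have : (1 / 2 : ℝ) ^ 3 ≤ L ^ 3 := by gcongr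
        linarith
      have b1 : 2 ^ 10 * 2 ^ n * (34 * L * (N + 1)) ^ 2 ≤
          2 ^ 10 * (2 ^ 19 * L * n0) * (34 * L * (N + 1)) ^ 2 := by gcongr
      have b2 : (1 : ℝ) ≤ 8 * L ^ 3 * n0 * (N + 1) ^ 2 := by
        have : (1 : ℝ) ≤ (N + 1 : ℝ) ^ 2 := one_le_pow₀ hM1
        exact one_le_mul_of_one_le_of_one_le (one_le_mul_of_one_le_of_one_le hL3 hn01) this
      calc _ ≤ (N : ℝ) * (1 + 2 ^ 10 * 2 ^ n * (34 * L * (N + 1)) ^ 2) := hsum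
        _ ≤ (N + 1 : ℝ) * (8 * L ^ 3 * n0 * (N + 1) ^ 2 +
              2 ^ 10 * (2 ^ 19 * L * n0) * (34 * L * (N + 1)) ^ 2) := by
            gcongr; linarith
        _ = (8 + 2 ^ 29 * 34 ^ 2) * L ^ 3 * n0 * (N + 1) ^ 3 := by ring
        _ ≤ (8 + 2 ^ 29 * 34 ^ 2) * L ^ 3 * n0 * (1331 * n0) := by gcongr
        _ = ((8 + 2 ^ 29 * 34 ^ 2) * 1331) * (L ^ 3 * n0 ^ 2) := by ring
        _ ≤ 2 ^ 50 * (L ^ 3 * n0 ^ 2) := by gcongr; norm_num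
        _ = _ := by ring
    exact mul_le_mul_of_nonneg_right (Real.exp_le_exp.2 hS) (Nat.cast_nonneg _)

end

section
variable {G : Type} [AddCommGroup G] [Fintype G] [DecidableEq G]

/-- bounded integer combinations of a finite set -/
noncomputable def box (T : Finset G) (n : ℕ) : Finset G :=
  (Fintype.piFinset (fun _ : T => Finset.Icc (-(n : ℤ)) n)).image (fun c => ∑ t : T, c t • (t : G))

lemma mem_box {T : Finset G} {n : ℕ} {x : G} : x ∈ box T n ↔
    ∃ c : T → ℤ, (∀ t, -(n : ℤ) ≤ c t ∧ c t ≤ n) ∧ ∑ t : T, c t • (t : G) = x := by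
  simp only [box, Finset.mem_image, Fintype.mem_piFinset, Finset.mem_Icc]

lemma box_card (T : Finset G) (n : ℕ) : (box T n).card ≤ (2 * n + 1) ^ T.card := by
  refine Finset.card_image_le.trans ?_
  rw [Fintype.card_piFinset]
  simp
  apply le_of_eq
  congr 1
  omega

lemma box_add (T : Finset G) (m n : ℕ) : box T m + box T n ⊆ box T (m + n) := by
  intro x hx
  obtain ⟨y, hy, z, hz, rfl⟩ := Finset.mem_add.1 hx
  obtain ⟨c, hc, rfl⟩ := mem_box.1 hy
  obtain ⟨c', hc', rfl⟩ := mem_box.1 hz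
  refine mem_box.2 ⟨c + c', fun t => ?_, ?_⟩
  · have := hc t; have := hc' t
    simp only [Pi.add_apply]; push_cast
    constructor <;> omega
  · rw [← Finset.sum_add_distrib]
    refine Finset.sum_congr rfl (fun t _ => ?_)
    simp [add_smul]

lemma zero_mem_box (T : Finset G) (n : ℕ) : (0 : G) ∈ box T n :=
  mem_box.2 ⟨0, fun t => by simp, by simp⟩

lemma sub_sums_mem_box (T T1 T2 : Finset G) (h1 : T1 ⊆ T) (h2 : T2 ⊆ T) :
    (∑ t ∈ T1, t) - ∑ t ∈ T2, t ∈ box T 1 := by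
  refine mem_box.2 ⟨fun t => (if (t : G) ∈ T1 then 1 else 0) - (if (t : G) ∈ T2 then 1 else 0),
    fun t => ?_, ?_⟩
  · dsimp only
    split_ifs <;> simp
  · have e : ∀ S ⊆ T, ∑ t : T, (if (t : G) ∈ S then (1 : ℤ) else 0) • (t : G) = ∑ t ∈ S, t := by
      intro S hS
      rw [Finset.sum_coe_sort T (fun t => (if t ∈ S then (1 : ℤ) else 0) • t)]
      simp only [ite_smul, one_smul, zero_smul]
      rw [← Finset.sum_filter]
      congr 1
      ext x; simp only [Finset.mem_filter]
      exact ⟨fun h => h.2, fun h => ⟨hS h, h⟩⟩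
    simp only [sub_smul, Finset.sum_sub_distrib]
    rw [e T1 h1, e T2 h2]

/-- strong dissociativity -/
def Diss (X T : Finset G) : Prop :=
  ∀ T1 ⊆ T, ∀ T2 ⊆ T, ∀ x ∈ X, ∀ y ∈ X, (∑ t ∈ T1, t) + x = (∑ t ∈ T2, t) + y → T1 = T2

lemma sum_mem_ns (Y T : Finset G) (hY : (0 : G) ∈ Y) (hT : T ⊆ Y) : ∑ t ∈ T, t ∈ ns Y T.card := by
  induction T using Finset.induction_on with
  | empty => simp [ns]
  | insert a s ha ih =>
    rw [Finset.sum_insert ha, Finset.card_insert_of_notMem ha, ns, add_comm a]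
    exact Finset.add_mem_add (ih (fun x hx => hT (Finset.mem_insert_of_mem hx)))
      (hT (Finset.mem_insert_self _ _))

lemma diss_card (X T : Finset G) (hX0 : (0 : G) ∈ X) (d : ℕ)
    (hd : ((ns X (3 * d + 1)).card : ℝ) < 2 ^ d * X.card)
    (hT : T ⊆ ns X 3) (hD : Diss X T) : T.card ≤ d := by
  by_contra! hcon
  obtain ⟨S, hST, hSc⟩ := Finset.exists_subset_card_eq hcon.le
  have : (S.powerset ×ˢ X).card ≤ (ns X (3 * d + 1)).card := by
    refine Finset.card_le_card_of_injOn (fun p => (∑ t ∈ p.1, t) + p.2) ?_ ?_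
    · rintro ⟨T1, x⟩ h
      rw [Finset.mem_coe, Finset.mem_product, Finset.mem_powerset] at h
      rw [Finset.mem_coe, ns_add, ns_one, ← ns_mul]
      refine Finset.add_mem_add ?_ h.2
      refine ns_le (zero_mem_ns hX0 3) ((Finset.card_le_card h.1).trans hSc.le) ?_
      exact sum_mem_ns _ _ (zero_mem_ns hX0 3) ((h.1.trans hST).trans hT)
    · rintro ⟨T1, x⟩ h ⟨T2, y⟩ h' e
      rw [Finset.mem_coe, Finset.mem_product, Finset.mem_powerset] at h h'
      simp only at e
      have := hD T1 (h.1.trans hST) T2 (h'.1.trans hST) x h.2 y h'.2 e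
      subst this
      simpa using e
  rw [Finset.card_product, Finset.card_powerset, hSc] at this
  have : (2 : ℝ) ^ d * X.card ≤ (ns X (3 * d + 1)).card := by exact_mod_cast this
  linarith

lemma chang_cover (X : Finset G) (hXs : -X = X) (hX0 : (0 : G) ∈ X) (d : ℕ)
    (hd : ((ns X (3 * d + 1)).card : ℝ) < 2 ^ d * X.card) :
    ∃ T : Finset G, T.card ≤ d ∧ ns X 3 ⊆ box T 1 + ns X 2 := by
  classical
  obtain ⟨T, hT, hmax⟩ := Finset.exists_max_image
    ((ns X 3).powerset.filter (fun T => Diss X T)) (fun T => T.card) ⟨∅, by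
      simp only [Finset.mem_filter, Finset.mem_powerset, Finset.empty_subset, true_and]
      intro T1 h1 T2 h2 _ _ _ _ _
      rw [Finset.subset_empty.1 h1, Finset.subset_empty.1 h2]⟩
  rw [Finset.mem_filter, Finset.mem_powerset] at hT
  refine ⟨T, diss_card X T hX0 d hd hT.1 hT.2, ?_⟩
  have e2 : ns X 2 = X - X := by
    rw [sub_eq_add_neg, hXs]; simp [ns, Finset.singleton_zero]
  intro y hy
  by_cases hyT : y ∈ T
  · have := sub_sums_mem_box T {y} ∅ (by simpa using hyT) (by simp)
    simp at this
    simpa using Finset.add_mem_add this (zero_mem_ns hX0 2)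
  · have hnot : ¬ Diss X (insert y T) := by
      intro hD
      have := hmax (insert y T) (by
        rw [Finset.mem_filter, Finset.mem_powerset]
        exact ⟨Finset.insert_subset hy hT.1, hD⟩)
      rw [Finset.card_insert_of_notMem hyT] at this
      omega
    unfold Diss at hnot
    push Not at hnot
    obtain ⟨T1, h1, T2, h2, x, hx, z, hz, e, hne⟩ := hnot
    rw [e2]
    by_cases hy1 : y ∈ T1
    · obtain ⟨S1, hyS1, rfl⟩ : ∃ S, y ∉ S ∧ insert y S = T1 :=
        ⟨T1.erase y, by simp, Finset.insert_erase hy1⟩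
      have hS1 : S1 ⊆ T := by
        intro a ha
        rcases Finset.mem_insert.1 (h1 (Finset.mem_insert_of_mem ha)) with rfl | h
        · exact absurd ha hyS1
        · exact h
      rw [Finset.sum_insert hyS1] at e
      by_cases hy2 : y ∈ T2
      · exfalso
        obtain ⟨S2, hyS2, rfl⟩ : ∃ S, y ∉ S ∧ insert y S = T2 :=
          ⟨T2.erase y, by simp, Finset.insert_erase hy2⟩
        have hS2 : S2 ⊆ T := by
          intro a ha
          rcases Finset.mem_insert.1 (h2 (Finset.mem_insert_of_mem ha)) with rfl | h
          · exact absurd ha hyS2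
          · exact h
        rw [Finset.sum_insert hyS2] at e
        apply hne
        rw [hT.2 S1 hS1 S2 hS2 x hx z hz (by rw [add_assoc, add_assoc] at e; exact add_left_cancel e)]
      · have hS2 : T2 ⊆ T := by
          intro a ha
          rcases Finset.mem_insert.1 (h2 ha) with rfl | h
          · exact absurd ha hy2
          · exact h
        have : y = ((∑ t ∈ T2, t) - ∑ t ∈ S1, t) + (z - x) := by
          rw [eq_sub_of_add_eq (show y + ((∑ t ∈ S1, t) + x) = (∑ t ∈ T2, t) + z by rw [← e]; abel)]
          abel
        rw [this]
        exact Finset.add_mem_add (sub_sums_mem_box T T2 S1 hS2 hS1) (Finset.sub_mem_sub hz hx)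
    · have hS1 : T1 ⊆ T := by
        intro a ha
        rcases Finset.mem_insert.1 (h1 ha) with rfl | h
        · exact absurd ha hy1
        · exact h
      by_cases hy2 : y ∈ T2
      · obtain ⟨S2, hyS2, rfl⟩ : ∃ S, y ∉ S ∧ insert y S = T2 :=
          ⟨T2.erase y, by simp, Finset.insert_erase hy2⟩
        have hS2 : S2 ⊆ T := by
          intro a ha
          rcases Finset.mem_insert.1 (h2 (Finset.mem_insert_of_mem ha)) with rfl | h
          · exact absurd ha hyS2
          · exact h
        rw [Finset.sum_insert hyS2] at e
        have : y = ((∑ t ∈ T1, t) - ∑ t ∈ S2, t) + (x - z) := by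
          rw [eq_sub_of_add_eq (show y + ((∑ t ∈ S2, t) + z) = (∑ t ∈ T1, t) + x by rw [e]; abel)]
          abel
        rw [this]
        exact Finset.add_mem_add (sub_sums_mem_box T T1 S2 hS1 hS2) (Finset.sub_mem_sub hx hz)
      · exfalso
        have hS2 : T2 ⊆ T := by
          intro a ha
          rcases Finset.mem_insert.1 (h2 ha) with rfl | h
          · exact absurd ha hy2
          · exact h
        exact hne (hT.2 T1 hS1 T2 hS2 x hx z hz e)

lemma poly_growth (X : Finset G) (hXs : -X = X) (hX0 : (0 : G) ∈ X) (d : ℕ) (hd1 : 1 ≤ d)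
    (hd : ((ns X (3 * d + 1)).card : ℝ) < 2 ^ d * X.card) (n : ℕ) :
    ((ns X n).card : ℝ) ≤ (4 * n + 2) ^ d * X.card := by
  obtain ⟨T, hTc, hT⟩ := chang_cover X hXs hX0 d hd
  have hind : ∀ n : ℕ, ns X (n + 2) ⊆ box T n + ns X 2 := by
    intro n
    induction n with
    | zero =>
      intro x hx
      simpa using Finset.add_mem_add (zero_mem_box T 0) hx
    | succ n ih =>
      have e : n + 1 + 2 = (n + 2) + 1 := by ring
      rw [e, ns]
      refine (Finset.add_subset_add_right ih).trans ?_
      have : box T n + ns X 2 + X = box T n + ns X 3 := by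
        rw [add_assoc]; rfl
      rw [this]
      refine (Finset.add_subset_add_left hT).trans ?_
      rw [← add_assoc]
      exact Finset.add_subset_add_right (box_add T n 1)
  have h1 : (ns X n).card ≤ (2 * n + 1) ^ d * (ns X 2).card := by
    refine (Finset.card_le_card ((ns_le hX0 (by omega)).trans (hind n))).trans ?_
    refine Finset.card_add_le.trans ?_
    gcongr
    exact (box_card T n).trans (Nat.pow_le_pow_right (by omega) hTc)
  have h2 : ((ns X 2).card : ℝ) ≤ 2 ^ d * X.card := by
    have : ((ns X 2).card : ℝ) ≤ (ns X (3 * d + 1)).card := by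
      exact_mod_cast Finset.card_le_card (ns_le hX0 (by omega))
    linarith
  calc ((ns X n).card : ℝ) ≤ (2 * n + 1) ^ d * (ns X 2).card := by exact_mod_cast h1
    _ ≤ (2 * n + 1) ^ d * (2 ^ d * X.card) := by gcongr
    _ = _ := by rw [← mul_assoc, ← mul_pow]; ring

lemma growth_small (A X : Finset G) (hA : A.Nonempty) (hX0 : (0 : G) ∈ X)
    (l : ℕ) (κ Dt : ℝ) (hκ0 : 0 ≤ κ) (hDt0 : 0 ≤ Dt) (hl : 12 * κ + 12 ≤ l)
    (hκ : ((A + ns X l).card : ℝ) ≤ Real.exp κ * A.card)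
    (hDt : (A.card : ℝ) ≤ Real.exp Dt * X.card) (d : ℕ) (hd : 3 * (κ + Dt + 1) ≤ d) :
    ((ns X (3 * d + 1)).card : ℝ) < 2 ^ d * X.card := by
  have hl0 : (0 : ℝ) < l := by linarith
  have hl1 : 0 < l := by exact_mod_cast hl0
  set n := ⌈((3 * d + 1 : ℕ) : ℝ) / l⌉₊ with hn
  have hn1 : ((3 * d + 1 : ℕ) : ℝ) / l ≤ n := Nat.le_ceil _
  have hn2 : (n : ℝ) < ((3 * d + 1 : ℕ) : ℝ) / l + 1 := Nat.ceil_lt_add_one (by positivity)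
  have hn3 : 3 * d + 1 ≤ l * n := by
    rw [div_le_iff₀ hl0] at hn1
    have h : 3 * d + 1 ≤ n * l := by exact_mod_cast hn1
    rwa [mul_comm n l] at h
  have h1 := growth_pluen A (ns X l) hA κ hκ n
  rw [ns_mul] at h1
  have h2 : ((ns X (3 * d + 1)).card : ℝ) ≤ (ns X (l * n)).card := by
    exact_mod_cast Finset.card_le_card (ns_le hX0 hn3)
  have hXc : (0 : ℝ) < X.card := by exact_mod_cast Finset.card_pos.2 ⟨0, hX0⟩
  have h3 : κ * n + Dt < d * Real.log 2 := by
    have a1 : κ * n ≤ κ * (((3 * d + 1 : ℕ) : ℝ) / l + 1) := by gcongr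
    have a2 : κ * (((3 * d + 1 : ℕ) : ℝ) / l) ≤ ((3 * d + 1 : ℕ) : ℝ) / 12 := by
      rw [mul_div_assoc', div_le_div_iff₀ hl0 (by norm_num)]
      have : (0 : ℝ) ≤ ((3 * d + 1 : ℕ) : ℝ) := by positivity
      nlinarith
    push_cast at a1 a2
    have := Real.log_two_gt_d9
    have : (d : ℝ) * 0.69 ≤ d * Real.log 2 := by gcongr; linarith
    rw [mul_add] at a1
    linarith
  calc _ ≤ _ := h2
    _ ≤ _ := h1
    _ ≤ Real.exp (κ * n) * (Real.exp Dt * X.card) := by gcongr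
    _ = Real.exp (κ * n + Dt) * X.card := by rw [Real.exp_add]; ring
    _ < Real.exp (d * Real.log 2) * X.card := by gcongr
    _ = _ := by rw [Real.exp_nat_mul, Real.exp_log (by norm_num)]

end

section
variable {G : Type} [AddCommGroup G] [Fintype G] [DecidableEq G]

/-- averaging operator -/
noncomputable def avg (W : Finset G) (f : G → ℝ) : G → ℝ :=
  fun x => (∑ w ∈ W, f (x + w)) / W.card

/-- Fourier transform (unnormalised) -/
noncomputable def ft (f : G → ℝ) (γ : AddChar G ℂ) : ℂ := ∑ x, (f x : ℂ) * γ x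

/-- Fourier transform of the uniform measure on a set -/
noncomputable def mu (W : Finset G) (γ : AddChar G ℂ) : ℂ := (∑ w ∈ W, γ w) / W.card

/-- indicator function of a finite set -/
noncomputable def ind (Z : Finset G) : G → ℝ := fun x => if x ∈ Z then 1 else 0

lemma ind_nonneg (Z : Finset G) (x : G) : 0 ≤ ind Z x := by
  unfold ind; split_ifs <;> norm_num

lemma sum_ind (Z : Finset G) : ∑ x, ind Z x = Z.card := by
  simp [ind]

lemma sum_ind_mul (Z : Finset G) (f : G → ℝ) : ∑ x, ind Z x * f x = ∑ x ∈ Z, f x := by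
  simp [ind]

lemma avg_nonneg (W : Finset G) (f : G → ℝ) (hf : ∀ x, 0 ≤ f x) (x : G) : 0 ≤ avg W f x :=
  div_nonneg (Finset.sum_nonneg (fun _ _ => hf _)) (Nat.cast_nonneg _)

lemma avg_iter_nonneg (W : Finset G) (f : G → ℝ) (hf : ∀ x, 0 ≤ f x) (n : ℕ) (x : G) :
    0 ≤ (avg W)^[n] f x := by
  induction n generalizing x with
  | zero => exact hf x
  | succ n ih => rw [Function.iterate_succ_apply']; exact avg_nonneg W _ ih x

lemma ft_avg (W : Finset G) (hW : -W = W) (f : G → ℝ) (γ : AddChar G ℂ) :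
    ft (avg W f) γ = mu W γ * ft f γ := by
  have h1 : ∑ w ∈ W, γ w = ∑ w ∈ W, γ (-w) := by
    conv_lhs => rw [← hW]
    rw [Finset.sum_neg_index]
  unfold ft mu avg
  rw [h1, div_mul_eq_mul_div, Finset.sum_mul, Finset.sum_congr rfl (g := fun x =>
    (∑ w ∈ W, (f (x + w) : ℂ) * γ x) / W.card), ← Finset.sum_div]
  · congr 1
    rw [Finset.sum_comm]
    refine Finset.sum_congr rfl (fun w _ => ?_)
    rw [Finset.mul_sum]
    refine Fintype.sum_equiv (Equiv.addRight w) _ _ (fun x => ?_)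
    simp only [Equiv.coe_addRight, AddChar.map_add_eq_mul]
    have : γ (-w) * γ w = 1 := by rw [← AddChar.map_add_eq_mul]; simp
    linear_combination (-(f (x + w) : ℂ) * γ x) * this
  · intro x _
    push_cast
    rw [div_mul_eq_mul_div, Finset.sum_mul]

lemma ft_avg_iter (W : Finset G) (hW : -W = W) (f : G → ℝ) (γ : AddChar G ℂ) (n : ℕ) :
    ft ((avg W)^[n] f) γ = mu W γ ^ n * ft f γ := by
  induction n with
  | zero => simp
  | succ n ih => rw [Function.iterate_succ_apply', ft_avg W hW, ih]; ring

lemma ft_zero (f : G → ℝ) : ft f 0 = ((∑ x, f x : ℝ) : ℂ) := by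
  simp [ft]

lemma mu_zero (W : Finset G) (hW : W.Nonempty) : mu W 0 = 1 := by
  have : (W.card : ℂ) ≠ 0 := by exact_mod_cast hW.card_pos.ne'
  simp [mu, this]

lemma sum_avg_iter (W : Finset G) (hW : -W = W) (hne : W.Nonempty) (f : G → ℝ) (n : ℕ) :
    ∑ x, (avg W)^[n] f x = ∑ x, f x := by
  have := ft_avg_iter W hW f 0 n
  rw [ft_zero, ft_zero, mu_zero W hne, one_pow, one_mul] at this
  exact_mod_cast this

lemma norm_ft_le (f : G → ℝ) (hf : ∀ x, 0 ≤ f x) (γ : AddChar G ℂ) : ‖ft f γ‖ ≤ ∑ x, f x := by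
  refine (norm_sum_le _ _).trans (Finset.sum_le_sum (fun x _ => ?_))
  rw [norm_mul, AddChar.norm_apply, mul_one, Complex.norm_real, Real.norm_of_nonneg (hf x)]

lemma avg_iter_one (X : Finset G) (hX0 : (0 : G) ∈ X) (f : G → ℝ) (j : ℕ) (n : ℕ) :
    ∀ a, (∀ x ∈ ns X (a + n * j), f x = 1) → ∀ x ∈ ns X a, (avg (ns X j))^[n] f x = 1 := by
  induction n with
  | zero => intro a h x hx; simpa using h x (by simpa using hx)
  | succ n ih =>
    intro a h x hx
    rw [Function.iterate_succ_apply']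
    have hc : ((ns X j).card : ℝ) ≠ 0 := by
      have : 0 < (ns X j).card := Finset.card_pos.2 ⟨0, zero_mem_ns hX0 j⟩
      positivity
    unfold avg
    rw [div_eq_one_iff_eq hc, Finset.sum_congr rfl (g := fun _ => (1 : ℝ))]
    · simp
    · intro w hw
      refine ih (a + j) ?_ (x + w) ?_
      · intro y hy
        apply h y
        rwa [show a + (n + 1) * j = a + j + n * j by ring]
      · rw [ns_add]; exact Finset.add_mem_add hx hw

lemma mu_real (X : Finset G) (hX : -X = X) (γ : AddChar G ℂ) : ((mu X γ).re : ℂ) = mu X γ := by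
  rw [← Complex.conj_eq_iff_re]
  unfold mu
  rw [map_div₀, map_sum, Complex.conj_natCast]
  congr 1
  have : ∑ w ∈ X, γ w = ∑ w ∈ X, γ (-w) := by
    conv_lhs => rw [← hX]
    rw [Finset.sum_neg_index]
  rw [this]
  refine Finset.sum_congr rfl (fun x _ => ?_)
  rw [AddChar.map_neg_eq_conj]

lemma spec_close (X W : Finset G) (hX0 : (0 : G) ∈ X) (hWne : W.Nonempty) (ρ : ℝ)
    (h : ((W + X).card : ℝ) ≤ (1 + ρ) * W.card) (γ : AddChar G ℂ) (hγ : 1 / 2 ≤ ‖mu W γ‖)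
    (x : G) (hx : x ∈ X) : ‖1 - γ x‖ ≤ 4 * ρ := by
  have hWc : (0 : ℝ) < W.card := by exact_mod_cast hWne.card_pos
  have key : ∀ V ⊆ W + X, V.card = W.card →
      ‖∑ y ∈ W + X, γ y - ∑ y ∈ V, γ y‖ ≤ ρ * W.card := by
    intro V hV hVc
    rw [← Finset.sum_sdiff hV, add_sub_cancel_right]
    refine (norm_sum_le _ _).trans ?_
    simp only [AddChar.norm_apply]
    rw [Finset.sum_const, nsmul_eq_mul, mul_one, Finset.card_sdiff_of_subset hV,
      Nat.cast_sub (Finset.card_le_card hV), hVc]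
    linarith
  have h1 := key W (fun w hw => by simpa using Finset.add_mem_add hw hX0) rfl
  have h2 := key (W.image (fun w => w + x)) (by
    intro y hy
    obtain ⟨w, hw, rfl⟩ := Finset.mem_image.1 hy
    exact Finset.add_mem_add hw hx) (Finset.card_image_of_injective _ (add_left_injective x))
  rw [Finset.sum_image (by intro a _ b _ h; simpa using h)] at h2
  simp only [AddChar.map_add_eq_mul] at h2
  rw [← Finset.sum_mul] at h2
  have h3 : ‖(∑ y ∈ W, γ y) * (1 - γ x)‖ ≤ 2 * (ρ * W.card) := by
    have : (∑ y ∈ W, γ y) * (1 - γ x) = (∑ y ∈ W + X, γ y - (∑ y ∈ W, γ y) * γ x) -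
        (∑ y ∈ W + X, γ y - ∑ y ∈ W, γ y) := by ring
    rw [this]
    refine (norm_sub_le _ _).trans ?_
    linarith
  have h4 : ∑ y ∈ W, γ y = mu W γ * W.card := by
    unfold mu; rw [div_mul_cancel₀]; exact_mod_cast hWc.ne'
  rw [h4, norm_mul, norm_mul, Complex.norm_natCast] at h3
  have h5 : (1 / 2 * W.card) * ‖1 - γ x‖ ≤ ‖mu W γ‖ * W.card * ‖1 - γ x‖ := by gcongr
  have h6 : W.card * ‖1 - γ x‖ ≤ W.card * (4 * ρ) := by linarith
  exact le_of_mul_le_mul_left h6 hWc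

/-- signed sums of a finite set of characters -/
noncomputable def sgn (Λ : Finset (AddChar G ℂ)) : Set (AddChar G ℂ) :=
  {e | ∃ σ : AddChar G ℂ → ℤ, (∀ l, σ l = 0 ∨ σ l = 1 ∨ σ l = -1) ∧ e = ∑ l ∈ Λ, σ l • l}

open Classical in
lemma sgn_insert {Λ : Finset (AddChar G ℂ)} {l e : AddChar G ℂ} (hl : l ∉ Λ) (he : e ∈ sgn Λ) :
    e ∈ sgn (insert l Λ) ∧ l + e ∈ sgn (insert l Λ) ∧ -l + e ∈ sgn (insert l Λ) := by
  obtain ⟨σ, hσ, rfl⟩ := he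
  have key : ∀ c : ℤ, (c = 0 ∨ c = 1 ∨ c = -1) → c • l + ∑ l ∈ Λ, σ l • l ∈ sgn (insert l Λ) := by
    intro c hc
    refine ⟨Function.update σ l c, ?_, ?_⟩
    · intro l'
      by_cases h : l' = l
      · subst h; simpa using hc
      · rw [Function.update_of_ne h]; exact hσ l'
    · rw [Finset.sum_insert hl, Function.update_self]
      congr 1
      refine Finset.sum_congr rfl (fun l' hl' => ?_)
      rw [Function.update_of_ne]
      rintro rfl; exact hl hl'
  refine ⟨by simpa using key 0 (by simp), by simpa using key 1 (by simp), by simpa using key (-1) (by simp)⟩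

lemma zero_mem_sgn (Λ : Finset (AddChar G ℂ)) : (0 : AddChar G ℂ) ∈ sgn Λ :=
  ⟨fun _ => 0, by simp, by simp⟩

/-- Riesz product transform -/
noncomputable def rp (w : G → ℝ) (a b : ℝ) (c : AddChar G ℂ → ℝ) (Λ : Finset (AddChar G ℂ))
    (χ : AddChar G ℂ) : ℂ :=
  ∑ x, (w x : ℂ) * χ x * ((∏ l ∈ Λ, (a + b * (c l * (l x).re)) : ℝ) : ℂ)

open Classical in
lemma rp_insert (w : G → ℝ) (a b : ℝ) (c : AddChar G ℂ → ℝ) (Λ : Finset (AddChar G ℂ))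
    (χ l : AddChar G ℂ) (hl : l ∉ Λ) :
    rp w a b c (insert l Λ) χ = a * rp w a b c Λ χ +
      b * c l / 2 * (rp w a b c Λ (χ + l) + rp w a b c Λ (χ - l)) := by
  unfold rp
  rw [Finset.mul_sum, ← Finset.sum_add_distrib, Finset.mul_sum, ← Finset.sum_add_distrib]
  refine Finset.sum_congr rfl (fun x _ => ?_)
  rw [Finset.prod_insert hl, sub_eq_add_neg, AddChar.add_apply, AddChar.add_apply, AddChar.neg_apply,
    AddChar.map_neg_eq_conj]
  have h := Complex.add_conj (l x)
  push_cast at h ⊢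
  linear_combination (-(w x : ℂ) * χ x * (∏ l ∈ Λ, ((a : ℂ) + b * (c l * ((l x).re : ℂ)))) * b * c l / 2) * h

lemma rp_bound (w : G → ℝ) (a b ε : ℝ) (ha : 0 ≤ a) (hb : 0 ≤ b) (c : AddChar G ℂ → ℝ)
    (hc : ∀ l, |c l| = 1) (Φ : Set (AddChar G ℂ)) (hΦ : ∀ γ ∉ Φ, ‖ft w γ‖ ≤ ε)
    (Λ : Finset (AddChar G ℂ)) :
    ∀ χ, (∀ e ∈ sgn Λ, χ + e ∉ Φ) → ‖rp w a b c Λ χ‖ ≤ ε * (a + b) ^ Λ.card := by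
  classical
  induction Λ using Finset.induction_on with
  | empty =>
    intro χ h
    have := hΦ χ (by simpa using h 0 (zero_mem_sgn _))
    simpa [rp, ft] using this
  | insert l Λ hl ih =>
    intro χ h
    rw [rp_insert w a b c Λ χ l hl, Finset.card_insert_of_notMem hl]
    have h0 := ih χ (fun e he => h e (sgn_insert hl he).1)
    have h1 := ih (χ + l) (fun e he => by rw [add_assoc]; exact h _ (sgn_insert hl he).2.1)
    have h2 := ih (χ - l) (fun e he => by
      rw [sub_eq_add_neg, add_assoc]; exact h _ (sgn_insert hl he).2.2)
    have n1 : ‖(a : ℂ) * rp w a b c Λ χ‖ ≤ a * (ε * (a + b) ^ Λ.card) := by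
      rw [norm_mul, Complex.norm_real, Real.norm_of_nonneg ha]; gcongr
    have n2 : ‖(b : ℂ) * c l / 2 * (rp w a b c Λ (χ + l) + rp w a b c Λ (χ - l))‖ ≤
        b / 2 * (ε * (a + b) ^ Λ.card + ε * (a + b) ^ Λ.card) := by
      rw [norm_mul, norm_div, norm_mul, Complex.norm_real, Complex.norm_real,
        Real.norm_of_nonneg hb, Real.norm_eq_abs, hc, mul_one]
      have : ‖(2 : ℂ)‖ = 2 := by simp
      rw [this]
      gcongr
      exact (norm_add_le _ _).trans (add_le_add h1 h2)
    refine (norm_add_le _ _).trans ((add_le_add n1 n2).trans (le_of_eq ?_))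
    rw [pow_succ]; ring

lemma greedy (w : G → ℝ) (hw : ∀ x, 0 ≤ w x) (a b ε : ℝ) (ha : 0 ≤ a) (hb : 0 ≤ b) (hε : 0 ≤ ε)
    (c : AddChar G ℂ → ℝ)
    (hc : ∀ l, |c l| = 1) (Φ Γ : Set (AddChar G ℂ)) (hΦ : ∀ γ ∉ Φ, ‖ft w γ‖ ≤ ε) (n : ℕ) :
    (∃ Λ : Finset (AddChar G ℂ), (∀ l ∈ Λ, l ∈ Γ) ∧ Λ.card = n ∧
      ‖rp w a b c Λ 0‖ ≤ (∑ x, w x) * a ^ n + ε * (a + b) ^ n) ∨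
    (∃ Λ : Finset (AddChar G ℂ), (∀ l ∈ Λ, l ∈ Γ) ∧ Λ.card < n ∧
      ∀ γ ∈ Γ, γ ∈ Λ ∨ ∃ e ∈ sgn Λ, γ + e ∈ Φ ∨ -γ + e ∈ Φ) := by
  classical
  induction n with
  | zero =>
    left
    refine ⟨∅, by simp, by simp, ?_⟩
    have := norm_ft_le w hw 0
    have e : rp w a b c ∅ 0 = ft w 0 := by simp [rp, ft]
    rw [e]
    simp only [pow_zero, mul_one]
    linarith
  | succ n ih =>
    rcases ih with ⟨Λ, hΛ, hcard, hr⟩ | ⟨Λ, hΛ, hcard, hr⟩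
    · by_cases hmax : ∀ γ ∈ Γ, γ ∈ Λ ∨ ∃ e ∈ sgn Λ, γ + e ∈ Φ ∨ -γ + e ∈ Φ
      · right; exact ⟨Λ, hΛ, by omega, hmax⟩
      · push Not at hmax
        obtain ⟨l, hlΓ, hl, he⟩ := hmax
        left
        refine ⟨insert l Λ, ?_, by rw [Finset.card_insert_of_notMem hl, hcard], ?_⟩
        · intro l' hl'
          rcases Finset.mem_insert.1 hl' with rfl | h
          · exact hlΓ
          · exact hΛ _ h
        · rw [rp_insert w a b c Λ 0 l hl, zero_add, zero_sub]
          have h1 := rp_bound w a b ε ha hb c hc Φ hΦ Λ l (fun e h => (he e h).1)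
          have h2 := rp_bound w a b ε ha hb c hc Φ hΦ Λ (-l) (fun e h => (he e h).2)
          rw [hcard] at h1 h2
          have n1 : ‖(a : ℂ) * rp w a b c Λ 0‖ ≤ a * ((∑ x, w x) * a ^ n + ε * (a + b) ^ n) := by
            rw [norm_mul, Complex.norm_real, Real.norm_of_nonneg ha]; gcongr
          have n2 : ‖(b : ℂ) * c l / 2 * (rp w a b c Λ l + rp w a b c Λ (-l))‖ ≤
              b / 2 * (ε * (a + b) ^ n + ε * (a + b) ^ n) := by
            rw [norm_mul, norm_div, norm_mul, Complex.norm_real, Complex.norm_real,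
              Real.norm_of_nonneg hb, Real.norm_eq_abs, hc, mul_one]
            have : ‖(2 : ℂ)‖ = 2 := by simp
            rw [this]
            gcongr
            exact (norm_add_le _ _).trans (add_le_add h1 h2)
          refine (norm_add_le _ _).trans ((add_le_add n1 n2).trans (le_of_eq ?_))
          rw [pow_succ, pow_succ]; ring
    · right; exact ⟨Λ, hΛ, by omega, hr⟩

end

lemma exp_le_cosh_sinh (t u : ℝ) (hu : |u| ≤ 1) :
    Real.exp (t * u) ≤ Real.cosh t + Real.sinh t * u := by
  have h := convexOn_exp.2 (Set.mem_univ t) (Set.mem_univ (-t))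
    (show 0 ≤ (1 + u) / 2 by linarith [(abs_le.1 hu).1])
    (show 0 ≤ (1 - u) / 2 by linarith [(abs_le.1 hu).2]) (by ring)
  simp only [smul_eq_mul] at h
  rw [Real.cosh_eq, Real.sinh_eq]
  rw [show t * u = (1 + u) / 2 * t + (1 - u) / 2 * -t by ring]
  linarith

section
variable {G : Type} [AddCommGroup G] [Fintype G] [DecidableEq G]

lemma riesz_lower (X : Finset G) (hX : -X = X) (hne : X.Nonempty) (w : G → ℝ) (hw0 : ∀ x, 0 ≤ w x)
    (hw : ∀ x ∈ X, 1 ≤ w x) (c : AddChar G ℂ → ℝ) (hc1 : ∀ l, |c l| = 1)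
    (hc : ∀ l, c l * (mu X l).re = |(mu X l).re|)
    (Λ : Finset (AddChar G ℂ)) (hΛ : ∀ l ∈ Λ, 1 / 2 ≤ ‖mu X l‖) :
    X.card * Real.exp (Λ.card / 4) ≤
      ‖rp w (Real.cosh (1 / 2)) (Real.sinh (1 / 2)) c Λ 0‖ := by
  have hXc : (0 : ℝ) < X.card := by exact_mod_cast hne.card_pos
  set a := Real.cosh (1 / 2)
  set b := Real.sinh (1 / 2)
  have hu : ∀ (l : AddChar G ℂ) (x : G), |c l * (l x).re| ≤ 1 := by
    intro l x
    rw [abs_mul, hc1, one_mul]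
    refine (Complex.abs_re_le_norm _).trans ?_
    rw [AddChar.norm_apply]
  have hfac : ∀ (l : AddChar G ℂ) (x : G), Real.exp (1 / 2 * (c l * (l x).re)) ≤
      a + b * (c l * (l x).re) := fun l x => exp_le_cosh_sinh _ _ (hu l x)
  set F : G → ℝ := fun x => ∑ l ∈ Λ, 1 / 2 * (c l * (l x).re) with hF
  have hprod : ∀ x, Real.exp (F x) ≤ ∏ l ∈ Λ, (a + b * (c l * (l x).re)) := by
    intro x
    simp only [hF]
    rw [Real.exp_sum]
    exact Finset.prod_le_prod (fun _ _ => (Real.exp_pos _).le) (fun l _ => hfac l x)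
  have hrp : rp w a b c Λ 0 = ((∑ x, w x * ∏ l ∈ Λ, (a + b * (c l * (l x).re)) : ℝ) : ℂ) := by
    unfold rp
    push_cast
    refine Finset.sum_congr rfl (fun x _ => ?_)
    simp
  rw [hrp, Complex.norm_real]
  refine le_trans ?_ (le_abs_self _)
  have h1 : ∑ x ∈ X, Real.exp (F x) ≤ ∑ x, w x * ∏ l ∈ Λ, (a + b * (c l * (l x).re)) := by
    refine le_trans (Finset.sum_le_sum (g := fun x => w x * ∏ l ∈ Λ, (a + b * (c l * (l x).re))) ?_)
      (Finset.sum_le_sum_of_subset_of_nonneg (Finset.subset_univ X) ?_)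
    · intro x hx
      calc _ = 1 * Real.exp (F x) := by ring
        _ ≤ _ := mul_le_mul (hw x hx) (hprod x) (Real.exp_pos _).le (hw0 x)
    · intro x _ _
      exact mul_nonneg (hw0 x) ((Real.exp_pos _).le.trans (hprod x))
  refine le_trans ?_ h1
  set s : ℝ := Λ.card / 4 with hs
  have h2 : ∀ x ∈ X, Real.exp s * (1 + F x - s) ≤ Real.exp (F x) := by
    intro x _
    have := Real.add_one_le_exp (F x - s)
    calc _ ≤ Real.exp s * Real.exp (F x - s) := by gcongr; linarith
      _ = _ := by rw [← Real.exp_add]; ring_nf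
  refine le_trans ?_ (Finset.sum_le_sum h2)
  rw [← Finset.mul_sum, Finset.sum_sub_distrib, Finset.sum_add_distrib, mul_comm]
  gcongr
  simp only [Finset.sum_const, nsmul_eq_mul, mul_one]
  have h3 : X.card * s ≤ ∑ x ∈ X, F x := by
    simp only [hF]
    rw [Finset.sum_comm]
    have h4 : ∀ l ∈ Λ, X.card * (1 / 4 : ℝ) ≤ ∑ x ∈ X, 1 / 2 * (c l * (l x).re) := by
      intro l hl
      have e1 : ∑ x ∈ X, 1 / 2 * (c l * (l x).re) = 1 / 2 * (c l * ∑ x ∈ X, (l x).re) := by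
        rw [Finset.mul_sum, Finset.mul_sum]
      have e2 : ∑ x ∈ X, (l x).re = X.card * (mu X l).re := by
        rw [← Complex.re_sum]
        have : ∑ w ∈ X, l w = ((X.card : ℝ) : ℂ) * mu X l := by
          unfold mu
          have : (X.card : ℂ) ≠ 0 := by exact_mod_cast hXc.ne'
          push_cast
          field_simp
        rw [this, Complex.re_ofReal_mul]
      have e3 : ‖mu X l‖ = |(mu X l).re| := by
        conv_lhs => rw [← mu_real X hX l]
        rw [Complex.norm_real, Real.norm_eq_abs]
      have e4 := hΛ l hl
      rw [e3, ← hc] at e4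
      rw [e1, e2]
      nlinarith
    have := Finset.sum_le_sum h4
    rw [Finset.sum_const, nsmul_eq_mul] at this
    rw [hs]
    linarith
  linarith

lemma chang_spec (X : Finset G) (hX : -X = X) (hX0 : (0 : G) ∈ X) (j r n : ℕ) (ρ D' : ℝ)
    (hW : ((ns X (j + 1)).card : ℝ) ≤ (1 + ρ) * (ns X j).card)
    (hZ : ((ns X (1 + r * j)).card : ℝ) ≤ Real.exp D' * X.card)
    (hnr : n ≤ r) (hn : 8 * (D' + 1) ≤ n) :
    ∃ Λ : Finset (AddChar G ℂ), Λ.card < n ∧ ∀ γ : AddChar G ℂ, 1 / 2 ≤ ‖mu X γ‖ →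
      γ ∈ Λ ∨ ∃ e ∈ sgn Λ, (∀ x ∈ X, ‖1 - (γ + e) x‖ ≤ 4 * ρ) ∨ (∀ x ∈ X, ‖1 - (-γ + e) x‖ ≤ 4 * ρ) := by
  have hne : X.Nonempty := ⟨0, hX0⟩
  have hXc : (0 : ℝ) < X.card := by exact_mod_cast hne.card_pos
  set W := ns X j with hWdef
  have hWne : W.Nonempty := ⟨0, zero_mem_ns hX0 j⟩
  have hWs : -W = W := ns_neg hX j
  set Z := ns X (1 + r * j) with hZdef
  set w := (avg W)^[r] (ind Z) with hw
  have hw0 : ∀ x, 0 ≤ w x := avg_iter_nonneg W _ (ind_nonneg Z) r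
  have hwsum : ∑ x, w x = Z.card := by
    rw [hw, sum_avg_iter W hWs hWne, sum_ind]
  have hw1 : ∀ x ∈ X, 1 ≤ w x := by
    intro x hx
    refine le_of_eq (avg_iter_one X hX0 (ind Z) j r 1 ?_ x ?_).symm
    · intro y hy; simp only [ind]; rw [if_pos hy]
    · rwa [ns_one]
  set Φ : Set (AddChar G ℂ) := {γ | ∀ x ∈ X, ‖1 - γ x‖ ≤ 4 * ρ} with hΦdef
  have hΦ : ∀ γ ∉ Φ, ‖ft w γ‖ ≤ (1 / 2) ^ r * Z.card := by
    intro γ hγ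
    have h1 : ‖mu W γ‖ < 1 / 2 := by
      by_contra! h
      exact hγ (fun x hx => spec_close X W hX0 hWne ρ hW γ h x hx)
    rw [hw, ft_avg_iter W hWs, norm_mul, norm_pow]
    have h2 := norm_ft_le (ind Z) (ind_nonneg Z) γ
    rw [sum_ind] at h2
    gcongr
  set c : AddChar G ℂ → ℝ := fun l => if 0 ≤ (mu X l).re then 1 else -1 with hc
  have hc1 : ∀ l, |c l| = 1 := by
    intro l; simp only [hc]; split_ifs <;> simp
  have hc2 : ∀ l, c l * (mu X l).re = |(mu X l).re| := by
    intro l; simp only [hc]; split_ifs with h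
    · rw [abs_of_nonneg h, one_mul]
    · rw [abs_of_neg (not_le.1 h)]; ring
  have hsinh : 0 ≤ Real.sinh (1 / 2) := by
    rw [Real.sinh_nonneg_iff]; norm_num
  rcases greedy w hw0 (Real.cosh (1 / 2)) (Real.sinh (1 / 2)) ((1 / 2) ^ r * Z.card)
    (Real.cosh_pos _).le hsinh (by positivity) c hc1 Φ {γ | 1 / 2 ≤ ‖mu X γ‖} hΦ n with
    ⟨Λ, hΛ, hcard, hb⟩ | ⟨Λ, hΛ, hcard, hb⟩
  · exfalso
    have h1 := (riesz_lower X hX hne w hw0 hw1 c hc1 hc2 Λ hΛ).trans hb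
    rw [hwsum, Real.cosh_add_sinh, hcard] at h1
    have h2 : Real.cosh (1 / 2) ^ n ≤ Real.exp (n / 8) := by
      calc _ ≤ (Real.exp ((1 / 2) ^ 2 / 2)) ^ n := by
            gcongr
            exact Real.cosh_le_exp_half_sq _
        _ = _ := by rw [← Real.exp_nat_mul]; ring_nf
    have h3 : (1 / 2 : ℝ) ^ r * Real.exp (1 / 2) ^ n ≤ Real.exp (n / 8) := by
      have a1 : (1 / 2 : ℝ) ^ r ≤ (1 / 2) ^ n := pow_le_pow_of_le_one (by norm_num) (by norm_num) hnr
      have a2 : (1 / 2 : ℝ) = Real.exp (- Real.log 2) := by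
        rw [Real.exp_neg, Real.exp_log (by norm_num)]; norm_num
      have a3 : (1 / 2 : ℝ) ≤ Real.exp (-(3 / 8)) := by
        rw [a2]; gcongr; have := Real.log_two_gt_d9; linarith
      calc _ ≤ (Real.exp (-(3 / 8))) ^ n * Real.exp (1 / 2) ^ n := by
            gcongr
            refine a1.trans ?_
            gcongr
        _ = _ := by rw [← mul_pow, ← Real.exp_add, ← Real.exp_nat_mul]; ring_nf
    have hZ0 : (0 : ℝ) ≤ Z.card := by positivity
    have h4 : X.card * Real.exp (n / 4) ≤ X.card * Real.exp (Real.log 2 + D' + n / 8) := by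
      calc _ ≤ _ := h1
        _ = Z.card * (Real.cosh (1 / 2) ^ n + (1 / 2 : ℝ) ^ r * Real.exp (1 / 2) ^ n) := by ring
        _ ≤ (Real.exp D' * X.card) * (Real.exp (n / 8) + Real.exp (n / 8)) := by
            gcongr
        _ = _ := by
          rw [Real.exp_add, Real.exp_add, Real.exp_log (by norm_num)]; ring
    have h5 := Real.exp_le_exp.1 (le_of_mul_le_mul_left h4 hXc)
    have := Real.log_two_lt_d9
    linarith
  · exact ⟨Λ, hcard, hb⟩

lemma cell_pigeon (X : Finset G) (hne : X.Nonempty) (Λ : Finset (AddChar G ℂ)) (M : ℕ) (hM : 1 ≤ M) :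
    ∃ Y ⊆ X, Y.Nonempty ∧ (X.card : ℝ) ≤ (2 * M + 1) ^ (2 * Λ.card) * Y.card ∧
      ∀ l ∈ Λ, ∀ y ∈ Y, ∀ y' ∈ Y, ‖l y - l y'‖ ≤ 2 / M := by
  classical
  have hM0 : (0 : ℝ) < M := by exact_mod_cast hM
  set I : Finset (ℤ × ℤ) := Finset.Icc (-(M : ℤ)) M ×ˢ Finset.Icc (-(M : ℤ)) M with hI
  set Q := Fintype.piFinset (fun _ : Λ => I) with hQ
  set f : G → (Λ → ℤ × ℤ) := fun x l => (⌊M * ((l : AddChar G ℂ) x).re⌋, ⌊M * ((l : AddChar G ℂ) x).im⌋) with hf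
  have hQc : (Q.card : ℝ) = (2 * M + 1) ^ (2 * Λ.card) := by
    rw [hQ, Fintype.card_piFinset]
    simp [hI]
    have : ((M : ℤ) + 1 + M).toNat = 2 * M + 1 := by omega
    rw [this]; push_cast; rw [pow_mul]; ring
  have hfl : ∀ u : ℝ, |u| ≤ 1 → -(M : ℤ) ≤ ⌊M * u⌋ ∧ ⌊M * u⌋ ≤ M := by
    intro u hu
    rw [abs_le] at hu
    constructor
    · rw [Int.le_floor]; push_cast; nlinarith
    · have : (⌊M * u⌋ : ℝ) ≤ M := (Int.floor_le _).trans (by nlinarith)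
      exact_mod_cast this
  have hmaps : ∀ x ∈ X, f x ∈ Q := by
    intro x _
    rw [hQ, Fintype.mem_piFinset]
    intro l
    have h1 : |((l : AddChar G ℂ) x).re| ≤ 1 :=
      (Complex.abs_re_le_norm _).trans (by rw [AddChar.norm_apply])
    have h2 : |((l : AddChar G ℂ) x).im| ≤ 1 :=
      (Complex.abs_im_le_norm _).trans (by rw [AddChar.norm_apply])
    rw [hI, Finset.mem_product, Finset.mem_Icc, Finset.mem_Icc]
    exact ⟨hfl _ h1, hfl _ h2⟩
  have hQne : Q.Nonempty := ⟨_, hmaps _ hne.choose_spec⟩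
  have hQpos : (0 : ℝ) < Q.card := by exact_mod_cast hQne.card_pos
  obtain ⟨q, hq, hq2⟩ := Finset.exists_le_card_fiber_of_nsmul_le_card_of_maps_to
    (b := (X.card : ℝ) / Q.card) hmaps hQne (by
      rw [nsmul_eq_mul, mul_div_cancel₀ _ hQpos.ne'])
  set Y := X.filter (fun x => f x = q) with hY
  have hYpos : (0 : ℝ) < Y.card := by
    refine lt_of_lt_of_le ?_ hq2
    have : (0 : ℝ) < X.card := by exact_mod_cast hne.card_pos
    positivity
  refine ⟨Y, Finset.filter_subset _ _, Finset.card_pos.1 (by exact_mod_cast hYpos), ?_, ?_⟩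
  · rw [div_le_iff₀ hQpos, hQc] at hq2
    linarith
  · intro l hl y hy y' hy'
    have e1 := (Finset.mem_filter.1 hy).2.trans (Finset.mem_filter.1 hy').2.symm
    have e2 := congrFun e1 ⟨l, hl⟩
    simp only [hf, Prod.mk.injEq] at e2
    have close : ∀ u v : ℝ, ⌊M * u⌋ = ⌊M * v⌋ → |u - v| ≤ 1 / M := by
      intro u v h
      have := Int.abs_sub_lt_one_of_floor_eq_floor h
      rw [← mul_sub, abs_mul, abs_of_pos hM0] at this
      rw [le_div_iff₀ hM0]; linarith
    have c1 := close _ _ e2.1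
    have c2 := close _ _ e2.2
    refine (Complex.norm_le_abs_re_add_abs_im _).trans ?_
    rw [Complex.sub_re, Complex.sub_im]
    calc _ ≤ 1 / (M : ℝ) + 1 / M := add_le_add c1 c2
      _ = _ := by ring

lemma norm_one_sub_add (γ δ : AddChar G ℂ) (u : G) :
    ‖1 - (γ + δ) u‖ ≤ ‖1 - γ u‖ + ‖1 - δ u‖ := by
  rw [AddChar.add_apply]
  have : 1 - γ u * δ u = (1 - γ u) + γ u * (1 - δ u) := by ring
  rw [this]
  refine (norm_add_le _ _).trans ?_
  rw [norm_mul, AddChar.norm_apply, one_mul]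

lemma norm_one_sub_neg (γ : AddChar G ℂ) (u : G) : ‖1 - (-γ) u‖ = ‖1 - γ u‖ := by
  rw [AddChar.neg_apply, AddChar.map_neg_eq_conj, ← Complex.norm_conj]
  simp

lemma norm_one_sub_sum (Λ : Finset (AddChar G ℂ)) (σ : AddChar G ℂ → ℤ)
    (hσ : ∀ l, σ l = 0 ∨ σ l = 1 ∨ σ l = -1) (u : G) (ε : ℝ) (hε : 0 ≤ ε)
    (h : ∀ l ∈ Λ, ‖1 - l u‖ ≤ ε) : ‖1 - (∑ l ∈ Λ, σ l • l) u‖ ≤ Λ.card * ε := by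
  classical
  induction Λ using Finset.induction_on with
  | empty => simp
  | insert l Λ hl ih =>
    rw [Finset.sum_insert hl, Finset.card_insert_of_notMem hl]
    refine (norm_one_sub_add _ _ _).trans ?_
    have h1 := ih (fun l hl => h l (Finset.mem_insert_of_mem hl))
    have h2 : ‖1 - (σ l • l) u‖ ≤ ε := by
      have h3 := h l (Finset.mem_insert_self _ _)
      rcases hσ l with e | e | e
      · rw [e]; simpa using hε
      · rw [e]; simpa using h3
      · rw [e, neg_smul, one_smul, norm_one_sub_neg]; exact h3
    rw [Nat.cast_add, Nat.cast_one]
    linarith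

lemma norm_one_sub_sub (γ : AddChar G ℂ) (y y' : G) : ‖1 - γ (y - y')‖ = ‖γ y - γ y'‖ := by
  have : γ y - γ y' = γ y' * (γ (y - y') - 1) := by
    rw [mul_sub, ← AddChar.map_add_eq_mul]; simp
  rw [this, norm_mul, AddChar.norm_apply, one_mul, norm_sub_rev]

end

section
variable {G : Type} [AddCommGroup G] [Fintype G] [DecidableEq G]

lemma pow_le_exp_log (a t : ℝ) (k : ℕ) (ht : 0 < t) (ha : a ≤ t ^ k) (ha0 : 0 ≤ a) (n : ℕ) :
    a ^ n ≤ Real.exp (k * n * Real.log t) := by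
  calc a ^ n ≤ (t ^ k) ^ n := by gcongr
    _ = Real.exp (k * n * Real.log t) := by
      rw [← pow_mul, mul_comm ((k : ℝ) * n), ← Nat.cast_mul, mul_comm (Real.log t), Real.exp_nat_mul, Real.exp_log ht]

lemma close_of_sgn (X Y : Finset G) (hYX : Y ⊆ X) (Λ : Finset (AddChar G ℂ)) (M : ℕ)
    (hM : M = 200 * (Λ.card + 1))
    (hY : ∀ l ∈ Λ, ∀ y ∈ Y, ∀ y' ∈ Y, ‖l y - l y'‖ ≤ 2 / M) (γ : AddChar G ℂ)
    (h : γ ∈ Λ ∨ ∃ e ∈ sgn Λ, (∀ x ∈ X, ‖1 - (γ + e) x‖ ≤ 4 * (1 / 1000)) ∨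
      (∀ x ∈ X, ‖1 - (-γ + e) x‖ ≤ 4 * (1 / 1000))) :
    ∀ y ∈ Y, ∀ y' ∈ Y, ‖1 - γ (y - y')‖ < 1 / 48 := by
  intro y hy y' hy'
  have hMr : (M : ℝ) = 200 * (Λ.card + 1) := by rw [hM]; push_cast; ring
  have hc0 : (0 : ℝ) ≤ Λ.card := by positivity
  have hM0 : (0 : ℝ) < M := by rw [hMr]; positivity
  have hM1 : 2 / (M : ℝ) ≤ 1 / 100 := by
    rw [div_le_iff₀ hM0, hMr]; linarith
  have hM2 : Λ.card * (2 / (M : ℝ)) ≤ 1 / 100 := by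
    rw [mul_div_assoc', div_le_iff₀ hM0, hMr]; linarith
  rcases h with h | ⟨e, ⟨σ, hσ, rfl⟩, h⟩
  · rw [norm_one_sub_sub]
    have := hY γ h y hy y' hy'
    linarith
  · have he : ‖1 - (∑ l ∈ Λ, σ l • l) (y - y')‖ ≤ 1 / 100 := by
      refine (norm_one_sub_sum Λ σ hσ (y - y') (2 / M) (by positivity) ?_).trans hM2
      intro l hl
      rw [norm_one_sub_sub]
      exact hY l hl y hy y' hy'
    have key : ∀ δ : AddChar G ℂ, (∀ x ∈ X, ‖1 - (δ + ∑ l ∈ Λ, σ l • l) x‖ ≤ 4 * (1 / 1000)) →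
        ‖1 - δ (y - y')‖ < 1 / 48 := by
      intro δ hδ
      have h1 := hδ y (hYX hy)
      have h2 := hδ y' (hYX hy')
      have h3 : ‖1 - (δ + ∑ l ∈ Λ, σ l • l) (y - y')‖ ≤ 8 / 1000 := by
        rw [norm_one_sub_sub]
        have := norm_sub_le ((1 : ℂ) - (δ + ∑ l ∈ Λ, σ l • l) y') (1 - (δ + ∑ l ∈ Λ, σ l • l) y)
        rw [sub_sub_sub_cancel_left] at this
        linarith
      have h4 := norm_one_sub_add (δ + ∑ l ∈ Λ, σ l • l) (-(∑ l ∈ Λ, σ l • l)) (y - y')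
      rw [norm_one_sub_neg, add_neg_cancel_right] at h4
      linarith
    rcases h with h | h
    · exact key _ h
    · rw [← norm_one_sub_neg]; exact key _ h

lemma spectrum_cell (X : Finset G) (hX : -X = X) (hX0 : (0 : G) ∈ X) (d : ℕ) (hd : 1 ≤ d)
    (hpg : ∀ n : ℕ, ((ns X n).card : ℝ) ≤ (4 * n + 2) ^ d * X.card) :
    ∃ Y ⊆ X, Y.Nonempty ∧ (X.card : ℝ) ≤ Real.exp (160 * d * Real.log (1000 * d) ^ 2) * Y.card ∧
      ∀ γ : AddChar G ℂ, 1 / 2 ≤ ‖mu X γ‖ → ∀ y ∈ Y, ∀ y' ∈ Y, ‖1 - γ (y - y')‖ < 1 / 48 := by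
  have hne : X.Nonempty := ⟨0, hX0⟩
  have hd1 : (1 : ℝ) ≤ d := by exact_mod_cast hd
  have hd2 : (d : ℝ) ≤ d ^ 2 := by nlinarith
  have ht : (0 : ℝ) < 1000 * d := by positivity
  obtain ⟨H, hH⟩ : ∃ H, H = Real.log (1000 * d) := ⟨_, rfl⟩
  have he : Real.exp 1 < 2.7182818286 := Real.exp_one_lt_d9
  have he' : 2.7182818283 < Real.exp 1 := Real.exp_one_gt_d9
  have hH1 : 1 ≤ H := by
    rw [hH, Real.le_log_iff_exp_le ht]; nlinarith
  have hH7 : H ≤ 7 * d := by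
    rw [hH, Real.log_mul (by norm_num) (by positivity)]
    have h1 := Real.log_le_sub_one_of_pos (show (0 : ℝ) < d by positivity)
    have h2 : Real.log 1000 ≤ 7 := by
      rw [Real.log_le_iff_le_exp (by norm_num)]
      have : Real.exp 7 = (Real.exp 1) ^ 7 := by rw [← Real.exp_nat_mul]; norm_num
      rw [this]
      calc (1000 : ℝ) ≤ 2.7182818283 ^ 7 := by norm_num
        _ ≤ _ := by gcongr
    linarith
  have hdH : d * H ≤ 7 * d ^ 2 := by nlinarith
  obtain ⟨J, hJ⟩ : ∃ J : ℕ, J = 100000 * d ^ 2 := ⟨_, rfl⟩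
  have hJr : (J : ℝ) = 100000 * d ^ 2 := by rw [hJ]; push_cast; ring
  have hJ1 : 1 ≤ J := by rw [hJ]; nlinarith
  obtain ⟨j, hjJ, hj⟩ := growth_pigeon (fun i => ((ns X (i + 1)).card : ℝ)) J hJ1 (2 * d * H) (by
    simp only [zero_add, ns_one]
    refine (hpg (J + 1)).trans ?_
    gcongr
    rw [hH]
    refine pow_le_exp_log _ _ 2 ht ?_ (by positivity) d
    push_cast; rw [hJr]; nlinarith)
  have hW : ((ns X (j + 1 + 1)).card : ℝ) ≤ (1 + 1 / 1000) * (ns X (j + 1)).card := by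
    refine hj.trans ?_
    gcongr
    have h1 : 2 * d * H / (J : ℝ) ≤ 1 / 1001 := by
      rw [hJr, div_le_iff₀ (by positivity)]; nlinarith
    have h2 : 1 - 1 / 1001 ≤ Real.exp (-(1 / 1001)) := by
      have := Real.add_one_le_exp (-(1 / 1001 : ℝ)); linarith
    have h3 : Real.exp (1 / 1001) * Real.exp (-(1 / 1001)) = 1 := by
      rw [← Real.exp_add]; simp
    have h4 := Real.exp_pos (1 / 1001)
    have h5 : Real.exp (2 * d * H / (J : ℝ)) ≤ Real.exp (1 / 1001) := Real.exp_le_exp.2 h1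
    nlinarith
  obtain ⟨r, hr⟩ : ∃ r : ℕ, r = 1000 * d ^ 2 := ⟨_, rfl⟩
  have hrr : (r : ℝ) = 1000 * d ^ 2 := by rw [hr]; push_cast; ring
  have hjr : ((j + 1 : ℕ) : ℝ) ≤ 100000 * d ^ 2 := by
    rw [← hJr]; exact_mod_cast hjJ
  have hZ : ((ns X (1 + r * (j + 1))).card : ℝ) ≤ Real.exp (4 * d * H) * X.card := by
    refine (hpg _).trans ?_
    gcongr
    rw [hH]
    refine pow_le_exp_log _ _ 4 ht ?_ (by positivity) d
    rw [Nat.cast_add, Nat.cast_mul, Nat.cast_one, hrr]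
    have h1 : 1000 * (d : ℝ) ^ 2 * ((j + 1 : ℕ) : ℝ) ≤ 1000 * (d : ℝ) ^ 2 * (100000 * d ^ 2) := by
      gcongr
    have h2 : (1 : ℝ) ≤ d ^ 4 := one_le_pow₀ hd1
    nlinarith
  obtain ⟨n, hn⟩ : ∃ n : ℕ, n = ⌈8 * (4 * d * H + 1)⌉₊ := ⟨_, rfl⟩
  have hn1 : 8 * (4 * d * H + 1) ≤ n := by rw [hn]; exact Nat.le_ceil _
  have hn2 : (n : ℝ) < 8 * (4 * d * H + 1) + 1 := by
    rw [hn]; exact Nat.ceil_lt_add_one (by positivity)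
  have hnr : n ≤ r := by
    have : (n : ℝ) ≤ r := by rw [hrr]; nlinarith
    exact_mod_cast this
  obtain ⟨Λ, hΛc, hΛ⟩ := chang_spec X hX hX0 (j + 1) r n (1 / 1000) (4 * d * H) hW hZ hnr hn1
  have hΛ1 : (Λ.card : ℝ) ≤ 40 * (d * H) := by
    have h1 : (Λ.card : ℝ) + 1 ≤ n := by exact_mod_cast hΛc
    have : 1 ≤ d * H := by nlinarith
    linarith
  obtain ⟨M, hM⟩ : ∃ M : ℕ, M = 200 * (Λ.card + 1) := ⟨_, rfl⟩
  obtain ⟨Y, hYX, hYne, hYc, hY⟩ := cell_pigeon X hne Λ M (by omega)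
  refine ⟨Y, hYX, hYne, ?_, fun γ hγ => close_of_sgn X Y hYX Λ M hM hY γ (hΛ γ hγ)⟩
  refine hYc.trans ?_
  gcongr
  have hMr : (M : ℝ) = 200 * (Λ.card + 1) := by rw [hM]; push_cast; ring
  refine (pow_le_exp_log _ (1000 * d) 2 ht ?_ (by positivity) _).trans ?_
  · rw [hMr]; nlinarith
  · rw [Real.exp_le_exp, ← hH]
    push_cast
    nlinarith
end

section
variable {G : Type} [AddCommGroup G] [Fintype G] [DecidableEq G]

lemma corr_fourier (f g : G → ℝ) (y : G) :
    ((Fintype.card G * ∑ x, f x * g (x - y) : ℝ) : ℂ) =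
      ∑ γ : AddChar G ℂ, ft f γ * (starRingEnd ℂ) (ft g γ) * γ (-y) := by
  have h1 : ∀ γ : AddChar G ℂ, ft f γ * (starRingEnd ℂ) (ft g γ) * γ (-y) =
      ∑ x, ∑ z, (f x : ℂ) * (g z : ℂ) * γ (x - z - y) := by
    intro γ
    unfold ft
    rw [map_sum, Finset.sum_mul_sum, Finset.sum_mul]
    refine Finset.sum_congr rfl fun x _ => ?_
    rw [Finset.sum_mul]
    refine Finset.sum_congr rfl fun z _ => ?_
    rw [map_mul, Complex.conj_ofReal, ← AddChar.map_neg_eq_conj, sub_eq_add_neg, sub_eq_add_neg,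
      AddChar.map_add_eq_mul, AddChar.map_add_eq_mul]
    ring
  rw [Finset.sum_congr rfl (fun γ _ => h1 γ), Finset.sum_comm]
  push_cast
  rw [Finset.mul_sum]
  refine Finset.sum_congr rfl fun x _ => ?_
  rw [Finset.sum_comm]
  have h2 : ∀ z : G, ∑ γ : AddChar G ℂ, (f x : ℂ) * (g z : ℂ) * γ (x - z - y) =
      if z = x - y then (f x : ℂ) * (g z : ℂ) * Fintype.card G else 0 := by
    intro z
    rw [← Finset.mul_sum, AddChar.sum_apply_eq_ite]
    have : x - z - y = 0 ↔ z = x - y := by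
      constructor
      · intro h; rw [sub_right_comm, sub_eq_zero] at h; exact h.symm
      · rintro rfl; abel
    simp only [this]
    split_ifs <;> simp
  rw [Finset.sum_congr rfl (fun z _ => h2 z), Finset.sum_ite_eq' Finset.univ (x - y)]
  simp only [Finset.mem_univ, if_true]
  ring

lemma avg_supp (X A : Finset G) (hX : -X = X) (n : ℕ) :
    ∀ x, (avg X)^[n] (ind A) x ≠ 0 → x ∈ A + ns X n := by
  induction n with
  | zero =>
    intro x hx
    simp only [Function.iterate_zero, id, ind] at hx
    have : x ∈ A := by by_contra h; simp [h] at hx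
    rw [show ns X 0 = ({0} : Finset G) from rfl, Finset.singleton_zero, add_zero]
    exact this
  | succ n ih =>
    intro x hx
    rw [Function.iterate_succ_apply'] at hx
    have : ∃ w ∈ X, (avg X)^[n] (ind A) (x + w) ≠ 0 := by
      by_contra! h
      apply hx
      unfold avg at h ⊢
      rw [Finset.sum_eq_zero h, zero_div]
    obtain ⟨w, hw, h⟩ := this
    have h2 := ih _ h
    have h3 : -w ∈ X := by rw [← hX]; exact Finset.neg_mem_neg hw
    have : x = x + w + -w := by abel
    rw [this]
    show _ ∈ A + (ns X n + X)
    rw [← add_assoc]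
    exact Finset.add_mem_add h2 h3

open Classical in
lemma bogo (A X : Finset G) (hA : A.Nonempty) (hX : -X = X) (hX0 : (0 : G) ∈ X) (l : ℕ) (κ : ℝ)
    (hκ0 : 0 ≤ κ) (hl : 12 * κ + 12 ≤ l) (hκ : ((A + ns X l).card : ℝ) ≤ Real.exp κ * A.card) :
    ∃ ν : G → ℝ, (∀ x, 0 ≤ ν x) ∧ ∑ x, ν x = A.card ∧
      ∀ y, (∀ γ : AddChar G ℂ, 1 / 2 ≤ ‖mu X γ‖ → 1 / 2 ≤ (γ y).re) →
        A.card * Real.exp (-κ) / 4 ≤ ∑ x, ν x * ind A (x - y) := by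
  have hne : X.Nonempty := ⟨0, hX0⟩
  have hAc : (0 : ℝ) < A.card := by exact_mod_cast hA.card_pos
  have hG : (0 : ℝ) < Fintype.card G := by exact_mod_cast Fintype.card_pos
  set ν := (avg X)^[2 * l] (ind A) with hν
  set g := (avg X)^[l] (ind A) with hg
  refine ⟨ν, avg_iter_nonneg X _ (ind_nonneg A) _, ?_, ?_⟩
  · rw [hν, sum_avg_iter X hX hne, sum_ind]
  intro y hy
  set c : AddChar G ℂ → ℝ := fun γ => ‖mu X γ‖ ^ (2 * l) * ‖ft (ind A) γ‖ ^ 2 with hc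
  have hc0 : ∀ γ, 0 ≤ c γ := fun γ => by simp only [hc]; positivity
  have hmu2 : ∀ γ, (mu X γ) ^ (2 * l) = ((‖mu X γ‖ ^ (2 * l) : ℝ) : ℂ) := by
    intro γ
    rw [← mu_real X hX γ, Complex.norm_real, Real.norm_eq_abs, pow_mul, pow_mul, sq_abs]
    push_cast; rfl
  -- R(y)
  have hR : Fintype.card G * ∑ x, ν x * ind A (x - y) = ∑ γ, c γ * (γ y).re := by
    have h := congrArg Complex.re (corr_fourier ν (ind A) y)
    rw [Complex.ofReal_re, Complex.re_sum] at h
    rw [h]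
    refine Finset.sum_congr rfl fun γ _ => ?_
    rw [hν, ft_avg_iter X hX, hmu2, mul_assoc (((‖mu X γ‖ ^ (2 * l) : ℝ) : ℂ)), Complex.mul_conj, Complex.normSq_eq_norm_sq,
      ← Complex.ofReal_mul, Complex.re_ofReal_mul, AddChar.map_neg_eq_conj, Complex.conj_re]
  have hR0 : Fintype.card G * ∑ x, g x * g x = ∑ γ, c γ := by
    have h := congrArg Complex.re (corr_fourier g g 0)
    rw [Complex.ofReal_re, Complex.re_sum] at h
    simp only [sub_zero] at h
    rw [h]
    refine Finset.sum_congr rfl fun γ _ => ?_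
    rw [neg_zero, AddChar.map_zero_eq_one, mul_one, Complex.mul_conj, Complex.normSq_eq_norm_sq,
      Complex.ofReal_re, hg, ft_avg_iter X hX, norm_mul, norm_pow]
    simp only [hc]; ring
  have hP : ∑ γ, ‖ft (ind A) γ‖ ^ 2 = Fintype.card G * A.card := by
    have h := congrArg Complex.re (corr_fourier (ind A) (ind A) 0)
    rw [Complex.ofReal_re, Complex.re_sum] at h
    simp only [sub_zero] at h
    have e : ∑ x, ind A x * ind A x = A.card := by
      rw [sum_ind_mul, ← sum_ind, ← sum_ind_mul]
      refine Finset.sum_congr rfl fun x _ => ?_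
      unfold ind; split_ifs <;> simp
    rw [e] at h
    rw [h]
    refine Finset.sum_congr rfl fun γ _ => ?_
    rw [neg_zero, AddChar.map_zero_eq_one, mul_one, Complex.mul_conj, Complex.normSq_eq_norm_sq,
      Complex.ofReal_re]
  -- lower bound for R(0)
  have hlow : A.card * Real.exp (-κ) ≤ ∑ x, g x * g x := by
    have hs : ∑ x ∈ A + ns X l, g x = A.card := by
      rw [← sum_ind, ← sum_avg_iter X hX hne (ind A) l]
      refine Finset.sum_subset (Finset.subset_univ _) fun x _ hx => ?_
      by_contra h
      exact hx (avg_supp X A hX l x h)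
    have h1 := sq_sum_le_card_mul_sum_sq (s := A + ns X l) (f := g)
    rw [hs] at h1
    have h2 : ∑ x ∈ A + ns X l, g x ^ 2 ≤ ∑ x, g x * g x := by
      simp only [← sq]
      exact Finset.sum_le_sum_of_subset_of_nonneg (Finset.subset_univ _) (fun _ _ _ => sq_nonneg _)
    have h3 : 0 ≤ ∑ x ∈ A + ns X l, g x ^ 2 := Finset.sum_nonneg fun _ _ => sq_nonneg _
    have h4 : (A.card : ℝ) ^ 2 ≤ Real.exp κ * A.card * ∑ x, g x * g x := by
      refine h1.trans ?_
      gcongr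
    have h5 : (A.card : ℝ) ≤ Real.exp κ * ∑ x, g x * g x := by nlinarith
    rw [Real.exp_neg, ← div_eq_mul_inv, div_le_iff₀ (Real.exp_pos _)]
    linarith
  -- tail
  set T := Finset.univ.filter (fun γ : AddChar G ℂ => ¬ (1 / 2 ≤ ‖mu X γ‖)) with hT
  have htail : ∑ γ ∈ T, c γ ≤ (1 / 4) ^ l * (Fintype.card G * A.card) := by
    rw [← hP, Finset.mul_sum]
    calc ∑ γ ∈ T, c γ ≤ ∑ γ ∈ T, (1 / 4) ^ l * ‖ft (ind A) γ‖ ^ 2 := by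
          refine Finset.sum_le_sum fun γ hγ => ?_
          rw [hT, Finset.mem_filter, not_le] at hγ
          simp only [hc]
          gcongr
          rw [pow_mul]
          gcongr
          nlinarith [norm_nonneg (mu X γ), hγ.2]
      _ ≤ _ := Finset.sum_le_sum_of_subset_of_nonneg (Finset.subset_univ _) (fun _ _ _ => by positivity)
  have hsm : (1 / 4 : ℝ) ^ l ≤ Real.exp (-κ) / 6 := by
    have a1 : (1 / 4 : ℝ) ≤ Real.exp (-1) := by
      rw [Real.exp_neg, one_div]
      have := Real.exp_one_lt_d9
      exact inv_anti₀ (Real.exp_pos _) (by linarith)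
    have a2 : (6 : ℝ) ≤ Real.exp 12 := by
      have := Real.add_one_le_exp (12 : ℝ); linarith
    calc (1 / 4 : ℝ) ^ l ≤ Real.exp (-1) ^ l := by gcongr
      _ = Real.exp (-l) := by rw [← Real.exp_nat_mul]; simp
      _ ≤ Real.exp (-κ - 12) := by rw [Real.exp_le_exp]; linarith
      _ = Real.exp (-κ) / Real.exp 12 := Real.exp_sub _ _
      _ ≤ _ := by gcongr
  have hmain : (1 / 2) * ∑ γ, c γ - (3 / 2) * ∑ γ ∈ T, c γ ≤ ∑ γ, c γ * (γ y).re := by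
    have e1 := Finset.sum_filter_add_sum_filter_not Finset.univ (fun γ : AddChar G ℂ => 1 / 2 ≤ ‖mu X γ‖) c
    have e2 := Finset.sum_filter_add_sum_filter_not Finset.univ (fun γ : AddChar G ℂ => 1 / 2 ≤ ‖mu X γ‖)
      (fun γ => c γ * (γ y).re)
    rw [← hT] at e1 e2
    have e3 : ∑ γ with 1 / 2 ≤ ‖mu X γ‖, (1 / 2) * c γ ≤ ∑ γ with 1 / 2 ≤ ‖mu X γ‖, c γ * (γ y).re := by
      refine Finset.sum_le_sum fun γ hγ => ?_
      have := hy γ (Finset.mem_filter.1 hγ).2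
      have := hc0 γ
      nlinarith
    have e4 : ∑ γ ∈ T, (-1) * c γ ≤ ∑ γ ∈ T, c γ * (γ y).re := by
      refine Finset.sum_le_sum fun γ hγ => ?_
      have h1 : |(γ y).re| ≤ 1 := (Complex.abs_re_le_norm _).trans (by rw [AddChar.norm_apply])
      have := (abs_le.1 h1).1
      have := hc0 γ
      nlinarith
    rw [← Finset.mul_sum] at e3 e4
    linarith
  rw [← hR, ← hR0] at hmain
  have h6 : (1 / 4 : ℝ) ^ l * (Fintype.card G * A.card) ≤ Real.exp (-κ) / 6 * (Fintype.card G * A.card) := by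
    gcongr
  have h7 : Fintype.card G * (A.card * Real.exp (-κ)) ≤ Fintype.card G * ∑ x, g x * g x := by
    gcongr
  refine le_of_mul_le_mul_left ?_ hG
  have h8 : (Fintype.card G : ℝ) * (A.card * Real.exp (-κ) / 4) = (1/2) * (Fintype.card G * (A.card * Real.exp (-κ)))
     - (3 / 2) * (Real.exp (-κ) / 6 * (Fintype.card G * A.card)) := by ring
  rw [h8]
  linarith

end

lemma circNorm_nonneg (z : ℂ) : 0 ≤ circNorm z := by
  unfold circNorm; positivity

lemma circNorm_mul (z w : ℂ) (hz : ‖z‖ = 1) (hw : ‖w‖ = 1) :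
    circNorm (z * w) ≤ circNorm z + circNorm w := by
  have hz0 : z ≠ 0 := by rintro rfl; simp at hz
  have hw0 : w ≠ 0 := by rintro rfl; simp at hw
  have h := InnerProductGeometry.angle_le_angle_add_angle (z * w) w 1
  rw [Complex.angle_eq_abs_arg (mul_ne_zero hz0 hw0) one_ne_zero,
    Complex.angle_eq_abs_arg (mul_ne_zero hz0 hw0) hw0, Complex.angle_eq_abs_arg hw0 one_ne_zero,
    div_one, div_one, mul_div_cancel_right₀ _ hw0] at h
  unfold circNorm
  rw [← add_div]
  gcongr

lemma circNorm_inv (z : ℂ) : circNorm z⁻¹ = circNorm z := by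
  unfold circNorm; rw [Complex.abs_arg_inv]

lemma circNorm_le (z : ℂ) (hz : ‖z‖ = 1) : circNorm z ≤ ‖1 - z‖ / 4 := by
  have hz0 : z ≠ 0 := by rintro rfl; simp at hz
  have h := Complex.angle_le_mul_norm_sub hz (norm_one (α := ℂ))
  rw [Complex.angle_eq_abs_arg hz0 one_ne_zero, div_one, norm_sub_rev] at h
  unfold circNorm
  rw [div_le_iff₀ (by positivity)]
  linarith

lemma re_ge_of_circNorm (z : ℂ) (hz : ‖z‖ = 1) (h : circNorm z < 1 / 6) : 1 / 2 ≤ z.re := by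
  have hz0 : z ≠ 0 := by rintro rfl; simp at hz
  have h1 := Complex.cos_arg hz0
  rw [hz, div_one] at h1
  rw [← h1, ← Real.cos_abs, ← Real.cos_pi_div_three]
  unfold circNorm at h
  rw [div_lt_iff₀ (by positivity)] at h
  have := Real.pi_pos
  exact Real.cos_le_cos_of_nonneg_of_le_pi (abs_nonneg _) (by linarith) (by linarith)

lemma circNorm_pow (z : ℂ) (hz : ‖z‖ = 1) (n : ℕ) (h : n * circNorm z < 1 / 2) :
    circNorm (z ^ n) = n * circNorm z := by
  have hpi := Real.pi_pos
  have h1 : z ^ n = Complex.cos ((n * z.arg : ℝ) : ℂ) + Complex.sin ((n * z.arg : ℝ) : ℂ) * Complex.I := by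
    rw [← Complex.exp_mul_I]
    conv_lhs => rw [← Complex.norm_mul_exp_arg_mul_I z, hz]
    rw [Complex.ofReal_one, one_mul, ← Complex.exp_nat_mul]
    push_cast; ring_nf
  have h2 : |(n * z.arg : ℝ)| < π := by
    unfold circNorm at h
    rw [abs_mul, Nat.abs_cast]
    rw [mul_div_assoc', div_lt_iff₀ (by positivity)] at h
    linarith
  rw [abs_lt] at h2
  unfold circNorm
  rw [h1, Complex.arg_cos_add_sin_mul_I ⟨h2.1, h2.2.le⟩, abs_mul, Nat.abs_cast]
  ring

section
variable {G : Type} [AddCommGroup G] [Fintype G] [DecidableEq G]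

/-- Bohr sets of constant width -/
def bo (Γ : Set (AddChar G ℂ)) (t : ℝ) : Set G := {x | ∀ γ ∈ Γ, circNorm (γ x) < t}

lemma bo_sub {Γ : Set (AddChar G ℂ)} {s t : ℝ} {x y : G} (hx : x ∈ bo Γ s) (hy : y ∈ bo Γ t) :
    x - y ∈ bo Γ (s + t) := by
  intro γ hγ
  have e : γ (x - y) = γ x * (γ y)⁻¹ := by
    rw [AddChar.map_sub_eq_div, div_eq_mul_inv]
  rw [e]
  have h := circNorm_mul (γ x) (γ y)⁻¹ (AddChar.norm_apply _ _)
    (by rw [norm_inv, AddChar.norm_apply, inv_one])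
  rw [circNorm_inv] at h
  have := hx γ hγ
  have := hy γ hγ
  linarith

lemma bo_add {Γ : Set (AddChar G ℂ)} {s t : ℝ} {x y : G} (hx : x ∈ bo Γ s) (hy : y ∈ bo Γ t) :
    x + y ∈ bo Γ (s + t) := by
  intro γ hγ
  rw [AddChar.map_add_eq_mul]
  have h := circNorm_mul (γ x) (γ y) (AddChar.norm_apply _ _) (AddChar.norm_apply _ _)
  have := hx γ hγ
  have := hy γ hγ
  linarith

lemma bo_mono {Γ : Set (AddChar G ℂ)} {s t : ℝ} (h : s ≤ t) : bo Γ s ⊆ bo Γ t :=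
  fun _ hx γ hγ => (hx γ hγ).trans_le h

lemma dCov_le (S T V : Set G) (F : Finset G) (hF : S ⊆ (F : Set G) + V) (hV : V - V ⊆ T) :
    dCoveringNumber S T ≤ (F.card : ℕ∞) := by
  unfold dCoveringNumber
  refine (iInf₂_le G (inferInstance : AddCommGroup G)).trans ?_
  unfold dCovAux
  refine (iInf_le _ (AddMonoidHom.id G)).trans ?_
  refine (iInf_le _ S).trans ?_
  refine (iInf_le _ V).trans ?_
  refine (iInf_le _ (by intro x hx; exact hx)).trans ?_
  refine (iInf_le _ (by intro x hx; exact hV hx)).trans ?_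
  exact sInf_le ⟨F, rfl, hF⟩

open Classical in
lemma scale_cover (Γ : Set (AddChar G ℂ)) (V : Set G) (hV : V ⊆ bo Γ (1 / 192)) (F : Finset G)
    (hF : bo Γ (1 / 12) ⊆ (F : Set G) + V) (t : ℝ) (ht : 0 < t) (ht1 : t ≤ 1 / 24) :
    ∃ F' : Finset G, F'.card ≤ F.card ∧ bo Γ t ⊆ (F' : Set G) + bo Γ (t / 4) := by
  obtain ⟨n, hn1, hn2, hn3⟩ : ∃ n : ℕ, 1 ≤ n ∧ 1 / 24 < n * t ∧ n * t ≤ 1 / 12 := by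
    refine ⟨⌊1 / 24 / t⌋₊ + 1, by omega, ?_, ?_⟩
    · have := Nat.lt_floor_add_one (1 / 24 / t)
      rw [div_lt_iff₀ ht] at this
      push_cast; exact this
    · have := Nat.floor_le (show 0 ≤ 1 / 24 / t by positivity)
      rw [le_div_iff₀ ht] at this
      push_cast; linarith
  have hn0 : (0 : ℝ) < n := by exact_mod_cast hn1
  set P : G → G → Prop := fun f x => x ∈ bo Γ t ∧ ∃ v ∈ V, n • x = f + v with hP
  set c : G → G := fun f => if h : ∃ x, P f x then h.choose else 0 with hc
  refine ⟨F.image c, Finset.card_image_le, ?_⟩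
  intro x hx
  have hnx : n • x ∈ bo Γ (1 / 12) := by
    intro γ hγ
    have h1 := hx γ hγ
    have h2 : n * circNorm (γ x) < 1 / 12 := lt_of_lt_of_le (by gcongr) hn3
    rw [AddChar.map_nsmul_eq_pow, circNorm_pow _ (AddChar.norm_apply _ _) n (by linarith)]
    exact h2
  obtain ⟨f, hf, v, hv, hfv⟩ := hF hnx
  have hex : ∃ x, P f x := ⟨x, hx, v, hv, hfv.symm⟩
  have hcf : P f (c f) := by
    simp only [hc]; rw [dif_pos hex]; exact hex.choose_spec
  obtain ⟨hcb, v', hv', hcv⟩ := hcf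
  refine ⟨c f, by simpa using ⟨f, hf, rfl⟩, x - c f, ?_, by abel⟩
  have hu := bo_sub hx hcb
  have hnu : n • (x - c f) ∈ bo Γ (1 / 192 + 1 / 192) := by
    have : n • (x - c f) = v - v' := by
      rw [smul_sub, ← hfv, hcv]; simp
    rw [this]; exact bo_sub (hV hv) (hV hv')
  intro γ hγ
  have h1 := hu γ hγ
  have h2 := hnu γ hγ
  have h3 : n * circNorm (γ (x - c f)) < 1 / 6 := by
    calc _ < n * (t + t) := by gcongr
      _ ≤ _ := by linarith
  rw [AddChar.map_nsmul_eq_pow, circNorm_pow _ (AddChar.norm_apply _ _) n (by linarith)] at h2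
  by_contra! h4
  have : n * (t / 4) ≤ n * circNorm (γ (x - c f)) := by gcongr
  linarith

open Classical in
lemma assemble (A A0 Y : Finset G) (hA0 : A0 ⊆ A) (hA0ne : A0.Nonempty) (hYne : Y.Nonempty)
    (Γ : Set (AddChar G ℂ)) (hY : ∀ γ ∈ Γ, ∀ y ∈ Y, ∀ y' ∈ Y, ‖1 - γ (y - y')‖ < 1 / 48)
    (ν : G → ℝ) (hν : ∀ x, 0 ≤ ν x) (hνs : ∑ x, ν x = A0.card) (ε : ℝ) (hε : 0 < ε)
    (hR : ∀ y, (∀ γ ∈ Γ, 1 / 2 ≤ (γ y).re) → A0.card * ε ≤ ∑ x, ν x * ind A0 (x - y))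
    (N : ℝ) (hAY : ((A + Y).card : ℝ) ≤ N * Y.card) (hN : (A0.card : ℝ) ≤ ε * (N * Y.card)) :
    ∃ B : BohrSystem G, (dCoveringNumber (A : Set G) (B.sets 1) : ℝ≥0∞) ≤ ENNReal.ofReal N ∧
      B.dim ≤ Real.logb 2 N ∧
      ∀ β : G → ℝ, IsProb β → (∀ y : G, β y ≠ 0 → y ∈ B.sets 1) →
        ε ≤ ⨆ x : G, |convR ((A : Set G).indicator (1 : G → ℝ)) β x| := by
  have hA0c : (0 : ℝ) < A0.card := by exact_mod_cast hA0ne.card_pos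
  have hYc : (0 : ℝ) < Y.card := by exact_mod_cast hYne.card_pos
  have hsets : ∀ η : ℝ, bohrSet Γ (fun _ => η * (1 / 24)) = bo Γ (η / 24) := by
    intro η; ext x; simp only [bohrSet, bo, mul_one_div]
  let B : BohrSystem G := ⟨fun η => bo Γ (η / 24), Γ, fun _ => 1 / 24, fun _ _ => by norm_num,
    fun η _ _ => (hsets η).symm⟩
  have hB : ∀ η, B.sets η = bo Γ (η / 24) := fun η => rfl
  have hre : ∀ y ∈ bo Γ (1 / 6), ∀ γ ∈ Γ, 1 / 2 ≤ (γ y).re := fun y hy γ hγ =>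
    re_ge_of_circNorm _ (AddChar.norm_apply _ _) (hy γ hγ)
  have hYY : ∀ y ∈ Y, ∀ y' ∈ Y, y - y' ∈ bo Γ (1 / 192) := by
    intro y hy y' hy' γ hγ
    have h1 := circNorm_le (γ (y - y')) (AddChar.norm_apply _ _)
    have h2 := hY γ hγ y hy y' hy'
    linarith
  have hYY' : ((Y - Y : Finset G) : Set G) ⊆ bo Γ (1 / 192) := by
    intro u hu
    obtain ⟨y, hy, y', hy', rfl⟩ := Finset.mem_sub.1 (Finset.mem_coe.1 hu)
    exact hYY y hy y' hy'
  -- size of the large Bohr set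
  set Bf : Finset G := Finset.univ.filter (· ∈ bo Γ (1 / 6)) with hBf
  have hBc : (Bf.card : ℝ) ≤ N * Y.card := by
    have h1 : Bf.card * (A0.card * ε) ≤ ∑ y, ∑ x, ν x * ind A0 (x - y) := by
      calc (Bf.card : ℝ) * (A0.card * ε) = ∑ y ∈ Bf, A0.card * ε := by rw [Finset.sum_const, nsmul_eq_mul]
        _ ≤ ∑ y ∈ Bf, ∑ x, ν x * ind A0 (x - y) :=
            Finset.sum_le_sum fun y hy => hR y (hre y (Finset.mem_filter.1 hy).2)
        _ ≤ _ := Finset.sum_le_sum_of_subset_of_nonneg (Finset.subset_univ _)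
            (fun y _ _ => Finset.sum_nonneg fun x _ => mul_nonneg (hν x) (ind_nonneg _ _))
    have h2 : ∑ y, ∑ x, ν x * ind A0 (x - y) = A0.card * A0.card := by
      rw [Finset.sum_comm]
      have : ∀ x, ∑ y, ν x * ind A0 (x - y) = ν x * A0.card := by
        intro x
        rw [← Finset.mul_sum, ← sum_ind A0]
        congr 1
        exact Fintype.sum_equiv (Equiv.subLeft x) _ _ (fun y => rfl)
      rw [Finset.sum_congr rfl (fun x _ => this x), ← Finset.sum_mul, hνs]
    rw [h2] at h1
    have h3 : Bf.card * ε ≤ A0.card := by nlinarith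
    have h4 : (Bf.card : ℝ) * ε ≤ (N * Y.card) * ε := by linarith
    exact le_of_mul_le_mul_right h4 hε
  -- covers
  obtain ⟨y0, hy0⟩ := hYne
  have hYne : Y.Nonempty := ⟨y0, hy0⟩
  set U : Finset G := Finset.univ.filter (· ∈ bo Γ (1 / 12)) with hU
  have hUY : ((U + Y).card : ℝ) ≤ N * Y.card := by
    refine le_trans ?_ hBc
    have : (U + Y) ⊆ Bf + {y0} := by
      intro z hz
      obtain ⟨u, hu, y, hy, rfl⟩ := Finset.mem_add.1 hz
      rw [Finset.mem_add]
      refine ⟨u + (y - y0), ?_, y0, by simp, by abel⟩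
      rw [hBf, Finset.mem_filter]
      exact ⟨Finset.mem_univ _, bo_mono (by norm_num) (bo_add (Finset.mem_filter.1 hu).2 (hYY y hy y0 hy0))⟩
    have h2 := Finset.card_le_card this
    rw [Finset.card_add_singleton] at h2
    exact_mod_cast h2
  obtain ⟨F, _, hFc, hF⟩ := Finset.ruzsa_covering_add hYne hUY
  obtain ⟨F1, _, hF1c, hF1⟩ := Finset.ruzsa_covering_add hYne hAY
  have hF' : bo Γ (1 / 12) ⊆ (F : Set G) + ((Y - Y : Finset G) : Set G) := by
    intro x hx
    have : x ∈ U := by rw [hU, Finset.mem_filter]; exact ⟨Finset.mem_univ _, hx⟩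
    have := Finset.mem_coe.2 (hF this)
    rwa [Finset.coe_add] at this
  have hN1 : 1 ≤ N := by
    have h1 : (Y.card : ℝ) ≤ (A + Y).card := by
      exact_mod_cast Finset.card_le_card_add_left (hA0ne.mono hA0)
    nlinarith
  refine ⟨B, ?_, ?_, ?_⟩
  · have h1 : dCoveringNumber (A : Set G) (B.sets 1) ≤ (F1.card : ℕ∞) := by
      refine dCov_le _ _ (bo Γ (1 / 48)) F1 ?_ ?_
      · intro x hx
        have := Finset.mem_coe.2 (hF1 (Finset.mem_coe.1 hx))
        rw [Finset.coe_add] at this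
        obtain ⟨f, hf, v, hv, e⟩ := this
        exact ⟨f, hf, v, bo_mono (by norm_num) (hYY' hv), e⟩
      · rintro z ⟨x, hx, y, hy, rfl⟩
        rw [hB]
        exact bo_mono (by norm_num) (bo_sub hx hy)
    calc (dCoveringNumber (A : Set G) (B.sets 1) : ℝ≥0∞) ≤ ((F1.card : ℕ∞) : ℝ≥0∞) := by
          exact_mod_cast h1
      _ = ENNReal.ofReal F1.card := by simp
      _ ≤ _ := ENNReal.ofReal_le_ofReal hF1c
  · have hlog : 0 ≤ Real.logb 2 N := Real.logb_nonneg (by norm_num) hN1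
    refine Real.sSup_le ?_ hlog
    rintro r ⟨η, hη0, hη1, rfl⟩
    obtain ⟨F', hF'c, hF'⟩ := scale_cover Γ _ hYY' F hF' (η / 24) (by positivity) (by linarith)
    have h1 : dCoveringNumber (B.sets η) (B.sets (η / 2)) ≤ (F'.card : ℕ∞) := by
      refine dCov_le _ _ _ F' hF' ?_
      rintro z ⟨x, hx, y, hy, rfl⟩
      rw [hB]
      exact bo_mono (by linarith) (bo_sub hx hy)
    have h2 : (dCoveringNumber (B.sets η) (B.sets (η / 2))).toNat ≤ F.card := by
      have := ENat.toNat_le_toNat h1 (by simp)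
      simp only [ENat.toNat_coe] at this
      exact this.trans hF'c
    have h3 : enatReal (dCoveringNumber (B.sets η) (B.sets (η / 2))) ≤ N := by
      unfold enatReal
      refine le_trans ?_ hFc
      exact_mod_cast h2
    rcases Nat.eq_zero_or_pos (dCoveringNumber (B.sets η) (B.sets (η / 2))).toNat with h0 | h0
    · unfold enatReal; rw [h0]; simpa using hlog
    · refine Real.logb_le_logb_of_le (by norm_num) ?_ h3
      unfold enatReal
      exact_mod_cast h0
  · intro β hβ hsupp
    set s := ⨆ x : G, |convR ((A : Set G).indicator (1 : G → ℝ)) β x| with hs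
    have hle : ∀ x, convR ((A : Set G).indicator (1 : G → ℝ)) β x ≤ s := fun x =>
      (le_abs_self _).trans (le_ciSup (f := fun x : G => |convR ((A : Set G).indicator (1 : G → ℝ)) β x|)
        (Set.finite_range _).bddAbove x)
    have h1 : ∑ x, ν x * convR ((A : Set G).indicator (1 : G → ℝ)) β x ≤ A0.card * s := by
      rw [← hνs, Finset.sum_mul]
      exact Finset.sum_le_sum fun x _ => mul_le_mul_of_nonneg_left (hle x) (hν x)
    have hind : ∀ z, ind A0 z ≤ (A : Set G).indicator (1 : G → ℝ) z := by
      intro z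
      unfold ind
      split_ifs with h
      · rw [Set.indicator_of_mem (Finset.mem_coe.2 (hA0 h))]; simp
      · exact Set.indicator_nonneg (fun _ _ => zero_le_one) _
    have h2 : A0.card * ε ≤ ∑ x, ν x * convR ((A : Set G).indicator (1 : G → ℝ)) β x := by
      calc A0.card * ε = ∑ y, β y * (A0.card * ε) := by rw [← Finset.sum_mul, hβ.2, one_mul]
        _ ≤ ∑ y, β y * ∑ x, ν x * ind A0 (x - y) := by
            refine Finset.sum_le_sum fun y _ => ?_
            by_cases hy : β y = 0
            · rw [hy]; simp
            · have hy2 := hsupp y hy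
              rw [hB] at hy2
              exact mul_le_mul_of_nonneg_left (hR y (hre y (bo_mono (by norm_num) hy2))) (hβ.1 y)
        _ = ∑ x, ν x * ∑ y, ind A0 (x - y) * β y := by
            simp only [Finset.mul_sum]
            rw [Finset.sum_comm]
            refine Finset.sum_congr rfl fun x _ => Finset.sum_congr rfl fun y _ => by ring
        _ ≤ _ := by
            refine Finset.sum_le_sum fun x _ => mul_le_mul_of_nonneg_left ?_ (hν x)
            unfold convR
            exact Finset.sum_le_sum fun y _ => mul_le_mul_of_nonneg_right (hind _) (hβ.1 y)
    have h3 := h2.trans h1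
    exact le_of_mul_le_mul_left h3 hA0c

end

lemma numerics (L n0 κ Dt d : ℝ) (hL : 1 / 2 ≤ L) (hn0 : 1 ≤ n0) (hκ : κ ≤ 66 * L * n0)
    (hDt : Dt ≤ 2 ^ 50 * L ^ 3 * n0 ^ 2) (hd1 : 1 ≤ d) (hd : d ≤ 3 * (κ + Dt + 1) + 1)
    (H : ℝ) (hH : H = Real.log (1000 * d)) (hLn : Real.log L ≤ n0) :
    2 + κ + 3 * L + Dt + 160 * d * H ^ 2 ≤ 2 ^ 74 * (L ^ 3 * n0 ^ 4) := by
  have hL0 : 0 < L := by linarith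
  have hL3 : 1 ≤ 8 * L ^ 3 := by
    have : (1 / 2 : ℝ) ^ 3 ≤ L ^ 3 := by gcongr
    linarith
  have hL2 : 1 ≤ 4 * L ^ 2 := by nlinarith
  have hLL3 : L ≤ 4 * L ^ 3 := by nlinarith
  have hn2 : n0 ≤ n0 ^ 2 := by nlinarith
  have hn2' : 1 ≤ n0 ^ 2 := by nlinarith
  have hn4 : n0 ^ 2 ≤ n0 ^ 4 := by nlinarith
  have hL3n : 0 < L ^ 3 := by positivity
  have a1 : L * n0 ≤ 4 * L ^ 3 * n0 ^ 2 := by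
    calc L * n0 ≤ (4 * L ^ 3) * n0 ^ 2 := by gcongr
      _ = _ := by ring
  have a2 : 1 ≤ 8 * L ^ 3 * n0 ^ 2 := by
    calc (1 : ℝ) = 1 * 1 := by ring
      _ ≤ (8 * L ^ 3) * n0 ^ 2 := by gcongr
  have a3 : d ≤ 2 ^ 52 * (L ^ 3 * n0 ^ 2) := by nlinarith
  have hH0 : 0 ≤ H := by rw [hH]; exact Real.log_nonneg (by linarith)
  have hlog2 : Real.log 2 ≤ 0.7 := by have := Real.log_two_lt_d9; linarith
  have hHle : H ≤ 67 * n0 := by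
    have h1 : H ≤ Real.log (2 ^ 62 * (L ^ 3 * n0 ^ 2)) := by
      rw [hH]; apply Real.log_le_log (by linarith)
      have : (0 : ℝ) ≤ L ^ 3 * n0 ^ 2 := by positivity
      linarith
    rw [Real.log_mul (by norm_num) (by positivity), Real.log_mul (by positivity) (by positivity),
      Real.log_pow, Real.log_pow, Real.log_pow] at h1
    have h2 : Real.log n0 ≤ n0 := (Real.log_le_sub_one_of_pos (by linarith)).trans (by linarith)
    push_cast at h1
    linarith
  have hH2 : H ^ 2 ≤ 2 ^ 13 * n0 ^ 2 := by
    calc H ^ 2 ≤ (67 * n0) ^ 2 := by gcongr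
      _ = 4489 * n0 ^ 2 := by ring
      _ ≤ _ := by nlinarith
  have a4 : d * H ^ 2 ≤ 2 ^ 65 * (L ^ 3 * n0 ^ 4) := by
    calc d * H ^ 2 ≤ (2 ^ 52 * (L ^ 3 * n0 ^ 2)) * (2 ^ 13 * n0 ^ 2) :=
          mul_le_mul a3 hH2 (by positivity) (by positivity)
      _ = _ := by ring
  have a5 : L ^ 3 * n0 ^ 2 ≤ L ^ 3 * n0 ^ 4 := by gcongr
  have a6 : L ≤ L * n0 := by nlinarith
  nlinarith

lemma choose_n0 (L : ℝ) (hL : Real.log 2 ≤ L) : ∃ n0 : ℕ, 1 ≤ n0 ∧ 2 * L ≤ 2 ^ n0 ∧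
    (2 : ℝ) ^ n0 ≤ 4 * L ∧ (n0 : ℝ) ≤ 6 * Real.log (2 * L) ∧ Real.log L ≤ n0 := by
  have hl := Real.log_two_gt_d9
  have hL0 : 0 < L := by linarith
  obtain ⟨n, h1, h2⟩ := exists_nat_pow_near (show (1 : ℝ) ≤ 2 * L by linarith) (show (1 : ℝ) < 2 by norm_num)
  refine ⟨n + 1, by omega, h2.le, by rw [pow_succ]; linarith, ?_, ?_⟩
  · have h3 : n * Real.log 2 ≤ Real.log (2 * L) := by
      rw [← Real.log_pow]; exact Real.log_le_log (by positivity) h1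
    have h4 : 0.27 ≤ Real.log (2 * L) := by
      have := Real.one_sub_inv_le_log_of_pos (show 0 < 2 * L by positivity)
      have h5 : (2 * L)⁻¹ ≤ 1.38⁻¹ := inv_anti₀ (by norm_num) (by linarith)
      have : (1.38 : ℝ)⁻¹ ≤ 0.73 := by norm_num
      linarith
    push_cast
    nlinarith
  · have h3 : Real.log L ≤ Real.log (2 ^ (n + 1)) := Real.log_le_log hL0 (by linarith)
    rw [Real.log_pow] at h3
    have := Real.log_two_lt_d9
    have h6 : (0 : ℝ) ≤ ((n + 1 : ℕ) : ℝ) := by positivity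
    nlinarith

section
variable {G : Type} [AddCommGroup G] [Fintype G] [DecidableEq G]

lemma core (A : Finset G) (hA : A.Nonempty) (K L : ℝ) (hK : ((A + A).card : ℝ) ≤ K * A.card)
    (hL : L = Real.log (2 * K)) (n0 : ℕ) (hn0 : 1 ≤ n0) (h1 : 2 * L ≤ 2 ^ n0)
    (h2 : (2 : ℝ) ^ n0 ≤ 4 * L) (hL1 : 1 / 2 ≤ L) (hK1 : 1 ≤ K) (hLn : Real.log L ≤ n0) :
    ∃ κ E : ℝ, κ ≤ 66 * L * n0 ∧ E ≤ 2 ^ 74 * (L ^ 3 * n0 ^ 4) ∧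
    ∃ B : BohrSystem G, (dCoveringNumber (A : Set G) (B.sets 1) : ℝ≥0∞) ≤ ENNReal.ofReal (Real.exp E) ∧
      B.dim ≤ Real.logb 2 (Real.exp E) ∧
      ∀ β : G → ℝ, IsProb β → (∀ y : G, β y ≠ 0 → y ∈ B.sets 1) →
        Real.exp (-κ) / 4 ≤ ⨆ x : G, |convR ((A : Set G).indicator (1 : G → ℝ)) β x| := by
  have hAc : (0 : ℝ) < A.card := by exact_mod_cast hA.card_pos
  obtain ⟨D, hD⟩ : ∃ D, D = A - A := ⟨_, rfl⟩
  have hKe : K ^ 3 ≤ Real.exp (3 * L) := by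
    have : Real.exp (3 * L) = (2 * K) ^ 3 := by
      rw [hL, show (3 : ℝ) = ((3 : ℕ) : ℝ) by norm_num, Real.exp_nat_mul, Real.exp_log (by linarith)]
    rw [this]
    gcongr
    linarith
  have hAD : ((A + D).card : ℝ) ≤ Real.exp (3 * L) * A.card := by
    have h := Finset.pluennecke_ruzsa_inequality_nsmul_sub_nsmul_add (A := A) hA A 2 1
    have e : (2 • A - 1 • A) = A + D := by
      rw [hD, two_nsmul, one_nsmul, add_sub_assoc]
    rw [e] at h
    have h' : ((A + D).card : ℝ) ≤ (((A + A).card : ℝ) / A.card) ^ (2 + 1) * A.card := by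
      have h3 := (NNRat.cast_le (K := ℝ)).2 h
      push_cast at h3
      exact h3
    refine h'.trans ?_
    gcongr
    refine le_trans ?_ hKe
    gcongr
    rwa [div_le_iff₀ hAc]
  obtain ⟨A0, hA0, hA0ne, hq⟩ := petridis A D hA _ hAD
  have hA0c : (0 : ℝ) < A0.card := by exact_mod_cast hA0ne.card_pos
  have hDs : -D = D := by rw [hD, neg_sub]
  have hD0 : (0 : G) ∈ D := by
    obtain ⟨a, ha⟩ := hA
    rw [hD, ← sub_self a]; exact Finset.sub_mem_sub ha ha
  obtain ⟨X, l, κ, Dt, hX, hX0, hκ0, hDt0, hκ, hDt, hl, hXl, hXc⟩ :=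
    iter_final A0 D hA0ne (by rw [hD]; exact Finset.sub_subset_sub hA0 hA0) hDs hD0 L hL1 hq n0 hn0 h1 h2
  obtain ⟨d, hd⟩ : ∃ d : ℕ, d = ⌈3 * (κ + Dt + 1)⌉₊ := ⟨_, rfl⟩
  have hd1 : 3 * (κ + Dt + 1) ≤ d := by rw [hd]; exact Nat.le_ceil _
  have hd2 : (d : ℝ) ≤ 3 * (κ + Dt + 1) + 1 := by
    rw [hd]; exact (Nat.ceil_lt_add_one (by positivity)).le
  have hd3 : (1 : ℝ) ≤ d := by linarith
  have hd4 : 1 ≤ d := by exact_mod_cast hd3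
  have hgs := growth_small A0 X hA0ne hX0 l κ Dt hκ0 hDt0 hl hXl hXc d hd1
  have hpg := poly_growth X hX hX0 d hd4 hgs
  obtain ⟨Y, hYX, hYne, hYc, hY⟩ := spectrum_cell X hX hX0 d hd4 hpg
  obtain ⟨ν, hν, hνs, hR⟩ := bogo A0 X hA0ne hX hX0 l κ hκ0 hl hXl
  have hYp : (0 : ℝ) < Y.card := by exact_mod_cast hYne.card_pos
  obtain ⟨Q, hQ⟩ : ∃ Q, Q = 160 * d * Real.log (1000 * d) ^ 2 := ⟨_, rfl⟩
  rw [← hQ] at hYc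
  have hA0Y : (A0.card : ℝ) ≤ Real.exp (Dt + Q) * Y.card := by
    refine hXc.trans ?_
    rw [Real.exp_add, mul_assoc]
    gcongr
  have he2 : (4 : ℝ) ≤ Real.exp 2 := by
    have : Real.exp 2 = Real.exp 1 ^ 2 := by rw [← Real.exp_nat_mul]; norm_num
    have := Real.exp_one_gt_d9
    nlinarith
  refine ⟨κ, 2 + κ + 3 * L + Dt + Q, hκ, ?_, ?_⟩
  · rw [hQ]
    exact numerics L n0 κ Dt d hL1 (by exact_mod_cast hn0) hκ hDt hd3 hd2 _ rfl hLn
  refine assemble A A0 Y hA0 hA0ne hYne {γ | 1 / 2 ≤ ‖mu X γ‖} hY ν hν hνs (Real.exp (-κ) / 4) (by positivity)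
    ?_ _ ?_ ?_
  · intro y hy
    rw [mul_div_assoc']
    exact hR y hy
  · have b1 : A + Y ⊆ X + A0 + D := by
      intro z hz
      obtain ⟨a, ha, y, hy, rfl⟩ := Finset.mem_add.1 hz
      obtain ⟨a0, ha0⟩ := hA0ne
      have : a + y = y + a0 + (a - a0) := by abel
      rw [this]
      refine Finset.add_mem_add (Finset.add_mem_add (hYX hy) ha0) ?_
      rw [hD]; exact Finset.sub_mem_sub ha (hA0 ha0)
    have b2 : ((A + Y).card : ℝ) ≤ (X + A0 + D).card := by exact_mod_cast Finset.card_le_card b1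
    have hl1 : 1 ≤ l := by
      have : (1 : ℝ) ≤ l := by linarith
      exact_mod_cast this
    have b3 : X + A0 ⊆ A0 + ns X l := by
      rw [add_comm]
      refine Finset.add_subset_add_left ?_
      have := ns_le hX0 hl1
      rwa [ns_one] at this
    have b4 : ((X + A0).card : ℝ) ≤ (A0 + ns X l).card := by exact_mod_cast Finset.card_le_card b3
    calc ((A + Y).card : ℝ) ≤ Real.exp (3 * L) * (X + A0).card := b2.trans (hq X)
      _ ≤ Real.exp (3 * L) * (Real.exp κ * (Real.exp (Dt + Q) * Y.card)) := by
          refine mul_le_mul_of_nonneg_left ?_ (Real.exp_pos _).le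
          refine (b4.trans hXl).trans ?_
          exact mul_le_mul_of_nonneg_left hA0Y (Real.exp_pos _).le
      _ = Real.exp (3 * L + κ + (Dt + Q)) * Y.card := by
          rw [Real.exp_add (3 * L + κ), Real.exp_add (3 * L)]; ring
      _ ≤ _ := by
          refine mul_le_mul_of_nonneg_right ?_ hYp.le
          rw [Real.exp_le_exp]; linarith
  · refine hA0Y.trans ?_
    have e : Real.exp (-κ) / 4 * (Real.exp (2 + κ + 3 * L + Dt + Q) * Y.card) =
        Real.exp 2 / 4 * (Real.exp (3 * L + (Dt + Q))) * Y.card := by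
      rw [show 2 + κ + 3 * L + Dt + Q = κ + (2 + (3 * L + (Dt + Q))) by ring, Real.exp_add κ, Real.exp_add 2,
        Real.exp_neg]
      field_simp
    rw [e]
    refine mul_le_mul_of_nonneg_right ?_ hYp.le
    have f1 : Real.exp (Dt + Q) ≤ Real.exp (3 * L + (Dt + Q)) := by
      rw [Real.exp_le_exp]; linarith
    have f2 := Real.exp_pos (3 * L + (Dt + Q))
    nlinarith

end

/-- Proposition 5.1, a Freĭman-type theorem. -/
theorem statement4 :
    ∃ C : ℝ, 0 < C ∧
      ∀ (G : Type) [AddCommGroup G] [Fintype G], ∀ (A : Set G) (K : ℝ),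
        A.Nonempty → haar (A + A) ≤ K * haar A →
        ∃ B : BohrSystem G,
          (dCoveringNumber A (B.sets 1) : ℝ≥0∞) ≤
            ENNReal.ofReal (Real.exp (C * Real.log (2 * K) ^ 3 *
              Real.log (2 * Real.log (2 * K)) ^ 4)) ∧
          B.dim ≤ C * Real.log (2 * K) ^ 3 * Real.log (2 * Real.log (2 * K)) ^ 4 ∧
          ∀ β : G → ℝ, IsProb β → (∀ y : G, β y ≠ 0 → y ∈ B.sets 1) →
            Real.exp (-(C * Real.log (2 * K) * Real.log (2 * Real.log (2 * K)))) ≤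
              ⨆ x : G, |convR (A.indicator (1 : G → ℝ)) β x| := by
  refine ⟨2 ^ 86, by norm_num, ?_⟩
  intro G _ _ A K hAne hK
  classical
  obtain ⟨Af, hAf⟩ : ∃ Af : Finset G, (Af : Set G) = A := ⟨A.toFinset, by simp⟩
  subst hAf
  have hA : Af.Nonempty := by simpa using hAne
  have hG : (0 : ℝ) < Fintype.card G := by exact_mod_cast Fintype.card_pos
  have hAc : (0 : ℝ) < Af.card := by exact_mod_cast hA.card_pos
  have hK' : ((Af + Af).card : ℝ) ≤ K * Af.card := by
    unfold haar at hK
    rw [← Finset.coe_add] at hK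
    simp only [Nat.card_eq_fintype_card, Finset.coe_sort_coe, Fintype.card_coe] at hK
    rw [mul_div_assoc', div_le_div_iff_of_pos_right hG] at hK
    exact hK
  have hK1 : 1 ≤ K := by
    have h1 : (Af.card : ℝ) ≤ (Af + Af).card := by
      exact_mod_cast Finset.card_le_card_add_left hA
    nlinarith
  obtain ⟨L, hL⟩ : ∃ L, L = Real.log (2 * K) := ⟨_, rfl⟩
  rw [← hL]
  have hL2 : Real.log 2 ≤ L := by
    rw [hL]; exact Real.log_le_log (by norm_num) (by linarith)
  have hlog := Real.log_two_gt_d9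
  have hL1 : 1 / 2 ≤ L := by linarith
  obtain ⟨n0, hn0, h1, h2, h3, h4⟩ := choose_n0 L hL2
  obtain ⟨LL, hLL⟩ : ∃ LL, LL = Real.log (2 * L) := ⟨_, rfl⟩
  rw [← hLL] at h3 ⊢
  have hn0r : (1 : ℝ) ≤ n0 := by exact_mod_cast hn0
  have hLL0 : 0 < LL := by linarith
  obtain ⟨κ, E, hκ, hE, B, hB1, hB2, hB3⟩ := core Af hA K L hK' hL n0 hn0 h1 h2 hL1 hK1 h4
  have hn4 : (n0 : ℝ) ^ 4 ≤ 1296 * LL ^ 4 := by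
    calc (n0 : ℝ) ^ 4 ≤ (6 * LL) ^ 4 := by gcongr
      _ = _ := by ring
  have hE2 : E ≤ 2 ^ 85 * (L ^ 3 * LL ^ 4) := by
    have hL3 : 0 ≤ L ^ 3 := by positivity
    have : L ^ 3 * (n0 : ℝ) ^ 4 ≤ L ^ 3 * (1296 * LL ^ 4) := mul_le_mul_of_nonneg_left hn4 hL3
    have : 0 ≤ L ^ 3 * LL ^ 4 := by positivity
    linarith
  have hpos : 0 ≤ L ^ 3 * LL ^ 4 := by positivity
  refine ⟨B, ?_, ?_, ?_⟩
  · refine hB1.trans (ENNReal.ofReal_le_ofReal (Real.exp_le_exp.2 ?_))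
    linarith
  · refine hB2.trans ?_
    rw [Real.logb, Real.log_exp, div_le_iff₀ (by linarith)]
    have : 2 ^ 86 * (L ^ 3 * LL ^ 4) * (1 / 2) ≤ 2 ^ 86 * (L ^ 3 * LL ^ 4) * Real.log 2 :=
      mul_le_mul_of_nonneg_left (by linarith) (by positivity)
    linarith
  · intro β hβ hs
    refine le_trans ?_ (hB3 β hβ hs)
    have h5 : L * n0 ≤ 6 * (L * LL) := by
      have : L * n0 ≤ L * (6 * LL) := mul_le_mul_of_nonneg_left h3 (by linarith)
      linarith
    have h6 : 1 ≤ 2 * (L * n0) := by nlinarith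
    have h7 : Real.exp (-κ) / Real.exp 2 ≤ Real.exp (-κ) / 4 := by
      have : Real.exp 2 = Real.exp 1 ^ 2 := by rw [← Real.exp_nat_mul]; norm_num
      have := Real.exp_one_gt_d9
      refine div_le_div_of_nonneg_left (Real.exp_pos _).le (by norm_num) ?_
      nlinarith
    refine le_trans ?_ h7
    rw [← Real.exp_sub, Real.exp_le_exp]
    have : 0 ≤ L * LL := by positivity
    linarith

end Paper
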